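/- arXiv:1609.04125 — 2 statements merged into one kernel-verified Lean document; each statement's English description precedes it below -/
import Mathlib

section
/- Let c ∈ (0,1) be irrational and let f : [0,1] → ℝ have a single jump discontinuity at c, be left-continuous at c, and satisfy: there are functions g_0 (twice differentiable with bounded second derivative on [0,c]) and g_1 (twice differentiable with bounded second derivative on [c,1]) with f(x) = g_0(x) for x ∈ [0,c], f(x) = g_1(x) for x ∈ (c,1], g_0(c) ≠ g_1(c), and f > 2 + δ for some δ > 0. Set f(c−) = g_0(c), f(c+) = g_1(c), α = (1/2)(f(1)+√(f(1)²−4))/((f(0)²−4)(f(1)²−4))^{1/4}, β = (f(c−) − f(c+) + √(f(c+)² − 4) + √(f(c−)² − 4)) / (2((f(c+)² − 4)(f(c−)² − 4))^{1/4}), and γ = (f(c+) + √(f(c+)² − 4)) / (f(c−) + √(f(c−)² − 4)). Then limsup_{n→∞} D_n(f)/G(f)^n = α·β·max{1, γ} and liminf_{n→∞} D_n(f)/G(f)^n = α·β·min{1, γ}. -/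
open Filter Topology

/-- The n×n discrete Schrödinger matrix with diagonal f(1/n), …, f(n/n) and −1 on the
first super- and subdiagonals. -/
noncomputable def Tmat (f : ℝ → ℝ) (n : ℕ) : Matrix (Fin n) (Fin n) ℝ :=
  Matrix.of fun i j =>
    if (i : ℕ) = (j : ℕ) then f (((i : ℕ) + 1 : ℝ) / (n : ℝ))
    else if (i : ℕ) + 1 = (j : ℕ) ∨ (j : ℕ) + 1 = (i : ℕ) then -1 else 0

/-- D_n(f) = det T_n(f). -/
noncomputable def Dn (f : ℝ → ℝ) (n : ℕ) : ℝ := (Tmat f n).det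

/-- G(f) = exp ∫₀¹ log((f(x) + √(f(x)² − 4))/2) dx. -/
noncomputable def Gf (f : ℝ → ℝ) : ℝ :=
  Real.exp (∫ x in (0:ℝ)..1, Real.log ((f x + Real.sqrt (f x ^ 2 - 4)) / 2))

/-- The tridiagonal matrix with diagonal `a 0, …, a (k - 1)` and off-diagonal entries `-1`. -/
noncomputable def tridiag (a : ℕ → ℝ) (k : ℕ) : Matrix (Fin k) (Fin k) ℝ :=
  Matrix.of fun i j =>
    if (i : ℕ) = (j : ℕ) then a i
    else if (i : ℕ) + 1 = (j : ℕ) ∨ (j : ℕ) + 1 = (i : ℕ) then -1 else 0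

lemma det_tridiag_succ_succ (a : ℕ → ℝ) (k : ℕ) :
    (tridiag a (k + 2)).det = a (k + 1) * (tridiag a (k + 1)).det - (tridiag a k).det := by
  have hminor : ((tridiag a (k + 2)).submatrix (Fin.last (k + 1)).succAbove
      (Fin.last k).castSucc.succAbove).det = -(tridiag a k).det := by
    rw [Matrix.det_succ_column _ (Fin.last k), Fin.sum_univ_castSucc, Finset.sum_eq_zero]
    · have h : ((tridiag a (k + 2)).submatrix (Fin.last (k + 1)).succAbove
          (Fin.last k).castSucc.succAbove).submatrix (Fin.last k).succAbove
          (Fin.last k).succAbove = tridiag a k := by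
        ext i j
        have hj : (Fin.last k).castSucc.succAbove j.castSucc = j.castSucc.castSucc :=
          Fin.succAbove_of_castSucc_lt _ _ (by simp [Fin.lt_def])
        simp [tridiag, hj]
      rw [h]
      simp [tridiag, ← two_mul]
    · intro i _
      have := i.2
      have h1 : (i : ℕ) ≠ k + 1 := by lia
      have h2 : (i : ℕ) ≠ k := by lia
      have h3 : k + 1 + 1 ≠ (i : ℕ) := by lia
      simp [tridiag, h1, h2, h3]
  have hlast : (tridiag a (k + 2)).submatrix (Fin.last (k + 1)).succAbove
      (Fin.last (k + 1)).succAbove = tridiag a (k + 1) := by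
    ext i j
    simp [tridiag]
  rw [Matrix.det_succ_row _ (Fin.last (k + 1)), Fin.sum_univ_castSucc, Fin.sum_univ_castSucc,
    Finset.sum_eq_zero, hminor, hlast]
  · have : (-1 : ℝ) ^ (k + 1 + k) = -1 := Odd.neg_one_pow ⟨k, by ring⟩
    simp [tridiag, this, ← two_mul]
    ring
  · intro j _
    have := j.2
    have h1 : k + 1 ≠ (j : ℕ) := by lia
    have h2 : (j : ℕ) ≠ k := by lia
    have h3 : k + 1 + 1 ≠ (j : ℕ) := by lia
    simp [tridiag, h1, h2, h3]

lemma det_tridiag_eq_prod {a t : ℕ → ℝ} (h0 : t 0 = 0)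
    (ht : ∀ j, t (j + 1) = (a j - t j)⁻¹) {n : ℕ} (hpos : ∀ j < n, 0 < a j - t j) :
    (tridiag a n).det = ∏ j ∈ Finset.range n, (t (j + 1))⁻¹ := by
  have key : ∀ k < n, (tridiag a (k + 1)).det = (a k - t k) * (tridiag a k).det := by
    intro k
    induction k with
    | zero =>
      intro _
      simp [tridiag, h0]
    | succ k ih =>
      intro hk
      have hp := hpos k (by lia)
      have ih' := ih (by lia)
      rw [det_tridiag_succ_succ, ht k]
      have : (tridiag a k).det = (a k - t k)⁻¹ * (tridiag a (k + 1)).det := by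
        rw [ih']; field_simp
      rw [this]; ring
  have h : ∀ k ≤ n, (tridiag a k).det = ∏ j ∈ Finset.range k, (t (j + 1))⁻¹ := by
    intro k
    induction k with
    | zero => intro _; simp
    | succ k ih =>
      intro hk
      rw [key k (by lia), ih (by lia), Finset.prod_range_succ, ht k, inv_inv, mul_comm]
  exact h n le_rfl

lemma abs_exp_neg_sub_exp_neg_le {x y : ℝ} (hx : 0 ≤ x) (hy : 0 ≤ y) :
    |Real.exp (-x) - Real.exp (-y)| ≤ |x - y| := by
  wlog h : x ≤ y generalizing x y
  · rw [abs_sub_comm, abs_sub_comm x]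
    exact this hy hx (le_of_not_ge h)
  have h1 : Real.exp (-y) = Real.exp (-x) * Real.exp (x - y) := by
    rw [← Real.exp_add]; ring_nf
  have h2 := Real.add_one_le_exp (x - y)
  have h3 : Real.exp (-x) ≤ 1 := Real.exp_le_one_iff.2 (by linarith)
  have h4 : Real.exp (-y) ≤ Real.exp (-x) := Real.exp_le_exp.2 (by linarith)
  rw [abs_of_nonneg (by linarith), abs_of_nonpos (by linarith)]
  nlinarith [Real.exp_pos (-x)]

lemma abs_log_one_sub_mul_sub_le {q t x y : ℝ} (hq : q < 1) (ht0 : 0 ≤ t) (ht1 : t ≤ 1)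
    (hx0 : 0 ≤ x) (hx : x ≤ q) (hy0 : 0 ≤ y) (hy : y ≤ q) :
    |(Real.log (1 - y * t) - Real.log (1 - x * t)) -
        (Real.log (1 - y ^ 2) / 2 - Real.log (1 - x ^ 2) / 2)| ≤
      (|t - x| + |y - x|) / (1 - q) ^ 2 * |y - x| := by
  have hq0 : 0 ≤ q := hx0.trans hx
  have hderiv : ∀ s ∈ Set.uIcc x y, HasDerivWithinAt
      (fun s => Real.log (1 - s * t) - Real.log (1 - s ^ 2) / 2)
      ((s - t) / ((1 - s * t) * (1 - s ^ 2))) (Set.uIcc x y) s := by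
    intro s hs
    have hs0 : 0 ≤ s := (le_min hx0 hy0).trans hs.1
    have hs1 : s ≤ q := hs.2.trans (max_le hx hy)
    have p1 : 0 < 1 - s * t := by nlinarith
    have p2 : 0 < 1 - s ^ 2 := by nlinarith
    have d1 : HasDerivAt (fun s : ℝ => 1 - s * t) (-t) s := by
      simpa using ((hasDerivAt_id s).mul_const t).const_sub 1
    have d2 : HasDerivAt (fun s : ℝ => 1 - s ^ 2) (-(2 * s)) s := by
      simpa using (hasDerivAt_pow 2 s).const_sub 1
    refine ((d1.log p1.ne').sub ((d2.log p2.ne').div_const 2)).hasDerivWithinAt.congr_deriv ?_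
    have p1' := p1.ne'
    have p2' := p2.ne'
    rw [div_div, div_sub_div _ _ p1' (mul_ne_zero p2' two_ne_zero),
      div_eq_div_iff (by positivity) (by positivity)]
    ring
  have hbound : ∀ s ∈ Set.uIcc x y, ‖(s - t) / ((1 - s * t) * (1 - s ^ 2))‖ ≤
      (|t - x| + |y - x|) / (1 - q) ^ 2 := by
    intro s hs
    have hs0 : 0 ≤ s := (le_min hx0 hy0).trans hs.1
    have hs1 : s ≤ q := hs.2.trans (max_le hx hy)
    have p1 : 1 - q ≤ 1 - s * t := by nlinarith
    have p2 : 1 - q ≤ 1 - s ^ 2 := by nlinarith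
    have p3 : (1 - q) ^ 2 ≤ (1 - s * t) * (1 - s ^ 2) := by
      rw [sq]; exact mul_le_mul p1 p2 (by linarith) (by linarith)
    have hq2 : 0 < (1 - q) ^ 2 := pow_pos (by linarith) 2
    rw [Real.norm_eq_abs, abs_div, abs_of_pos (hq2.trans_le p3)]
    have hst : |s - t| ≤ |t - x| + |y - x| := by
      have h1 : |s - x| ≤ |y - x| := Set.abs_sub_left_of_mem_uIcc hs
      have h2 : |s - t| ≤ |s - x| + |x - t| := abs_sub_le _ _ _
      rw [abs_sub_comm x t] at h2
      linarith
    gcongr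
  have := (convex_uIcc x y).norm_image_sub_le_of_norm_hasDerivWithin_le hderiv hbound
    Set.left_mem_uIcc Set.right_mem_uIcc
  rw [Real.norm_eq_abs, Real.norm_eq_abs] at this
  convert this using 2
  ring

/-- One step of the Riccati recurrence `s = (2 * cosh l - t)⁻¹`. -/
lemma riccati_step {l l0 t : ℝ} (hl0 : 0 < l0) (hl : l0 ≤ l) (ht1 : t ≤ 1) :
    0 < 2 * Real.cosh l - t ∧ 0 < (2 * Real.cosh l - t)⁻¹ ∧ (2 * Real.cosh l - t)⁻¹ ≤ 1 ∧
    |(2 * Real.cosh l - t)⁻¹ - Real.exp (-l)| ≤ Real.exp (-l0) * |t - Real.exp (-l)| ∧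
    -Real.log (2 * Real.cosh l - t)⁻¹ = l + Real.log (1 - Real.exp (-l) * t) -
      Real.log (1 - Real.exp (-l) * (2 * Real.cosh l - t)⁻¹) := by
  have hc : 2 * Real.cosh l = Real.exp l + Real.exp (-l) := by rw [Real.cosh_eq]; ring
  have hc1 : 1 ≤ Real.cosh l := Real.one_le_cosh l
  set μ := Real.exp (-l) with hμ
  have hμ0 : 0 < μ := Real.exp_pos _
  have hμ1 : μ < 1 := Real.exp_lt_one_iff.2 (by linarith)
  have hμq : μ ≤ Real.exp (-l0) := Real.exp_le_exp.2 (by linarith)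
  have hlm : Real.exp l = μ⁻¹ := by rw [hμ, Real.exp_neg, inv_inv]
  have hpos : 0 < 2 * Real.cosh l - t := by linarith
  set s := (2 * Real.cosh l - t)⁻¹ with hs
  have hs0 : 0 < s := inv_pos.2 hpos
  have hs1 : s ≤ 1 := inv_le_one_of_one_le₀ (by linarith)
  have hss : s * (μ⁻¹ + μ - t) = 1 := by
    rw [← hlm, ← hc, hs]; exact inv_mul_cancel₀ hpos.ne'
  have hss' : s * (1 + μ ^ 2 - μ * t) = μ := by
    have : s * (1 + μ ^ 2 - μ * t) = μ * (s * (μ⁻¹ + μ - t)) := by field_simp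
    rw [this, hss, mul_one]
  refine ⟨hpos, hs0, hs1, ?_, ?_⟩
  · have : s - μ = s * μ * (t - μ) := by linarith
    rw [this, abs_mul, abs_of_pos (mul_pos hs0 hμ0)]
    gcongr
    nlinarith
  · have p1 : 0 < 1 - μ * t := by nlinarith
    have p2 : 0 < 1 - μ * s := by nlinarith
    have : s⁻¹ = Real.exp l * ((1 - μ * t) / (1 - μ * s)) := by
      rw [hlm, eq_comm, ← mul_div_assoc, div_eq_iff p2.ne']
      field_simp
      linarith
    rw [← Real.log_inv, this, Real.log_mul (Real.exp_pos _).ne' (by positivity), Real.log_exp,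
      Real.log_div p1.ne' p2.ne']
    ring

/-- Quantitative asymptotics of the product of the solutions of a Riccati recurrence with
slowly varying coefficients. -/
lemma riccati_sum_estimate {l0 D : ℝ} (hl0 : 0 < l0) (hD : 0 ≤ D) {l t : ℕ → ℝ} (N : ℕ)
    (hl : ∀ j ≤ N, l0 ≤ l j) (hvar : ∀ j < N, |l (j + 1) - l j| ≤ D)
    (ht0 : 0 ≤ t 0) (ht1 : t 0 ≤ 1) (ht : ∀ j ≤ N, t (j + 1) = (2 * Real.cosh (l j) - t j)⁻¹) :
    (∀ j ≤ N + 1, 0 ≤ t j ∧ t j ≤ 1) ∧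
    |t (N + 1) - Real.exp (-l N)| ≤ Real.exp (-l0) ^ N + D / (1 - Real.exp (-l0)) ∧
    |∑ j ∈ Finset.range (N + 1), -Real.log (t (j + 1)) -
      (∑ j ∈ Finset.range (N + 1), l j + Real.log (1 - Real.exp (-l 0) * t 0) -
        Real.log (1 - Real.exp (-l N) * t (N + 1)) +
        (Real.log (1 - Real.exp (-l N) ^ 2) / 2 - Real.log (1 - Real.exp (-l 0) ^ 2) / 2))| ≤
      ∑ j ∈ Finset.range N, (Real.exp (-l0) ^ j + D / (1 - Real.exp (-l0)) + D) /
        (1 - Real.exp (-l0)) ^ 2 * D := by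
  have hq0 : 0 < Real.exp (-l0) := Real.exp_pos _
  have hq1 : Real.exp (-l0) < 1 := Real.exp_lt_one_iff.2 (by linarith)
  induction N with
  | zero =>
    obtain ⟨h1, h2, h3, h4, h5⟩ := riccati_step hl0 (hl 0 le_rfl) ht1
    rw [← ht 0 le_rfl] at h2 h3 h4 h5
    refine ⟨fun j hj => ?_, ?_, ?_⟩
    · interval_cases j
      exacts [⟨ht0, ht1⟩, ⟨h2.le, h3⟩]
    · have hμ0 : 0 < Real.exp (-l 0) := Real.exp_pos _
      have hμ1 : Real.exp (-l 0) < 1 := Real.exp_lt_one_iff.2 (by linarith [hl 0 le_rfl])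
      have : |t (0 + 1) - Real.exp (-l 0)| ≤ 1 := by rw [abs_le]; constructor <;> linarith
      have : 0 ≤ D / (1 - Real.exp (-l0)) := div_nonneg hD (by linarith)
      rw [pow_zero]
      linarith
    · simp [h5]
  | succ N ih =>
    obtain ⟨ih1, ih2, ih3⟩ := ih (fun j hj => hl j (by lia)) (fun j hj => hvar j (by lia))
      (fun j hj => ht j (by lia))
    obtain ⟨hT0, hT1⟩ := ih1 (N + 1) le_rfl
    obtain ⟨h1, h2, h3, h4, h5⟩ := riccati_step hl0 (hl (N + 1) le_rfl) hT1
    rw [← ht (N + 1) le_rfl] at h2 h3 h4 h5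
    have hd : |Real.exp (-l (N + 1)) - Real.exp (-l N)| ≤ D :=
      (abs_exp_neg_sub_exp_neg_le (hl0.le.trans (hl _ le_rfl))
        (hl0.le.trans (hl _ (by lia)))).trans (hvar N (by lia))
    refine ⟨fun j hj => ?_, ?_, ?_⟩
    · rcases Nat.lt_or_ge j (N + 1 + 1) with h | h
      · exact ih1 j (by lia)
      · obtain rfl : j = N + 1 + 1 := by lia
        exact ⟨h2.le, h3⟩
    · have htri : |t (N + 1) - Real.exp (-l (N + 1))| ≤
          Real.exp (-l0) ^ N + D / (1 - Real.exp (-l0)) + D := by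
        have := abs_sub_le (t (N + 1)) (Real.exp (-l N)) (Real.exp (-l (N + 1)))
        rw [abs_sub_comm (Real.exp (-l N))] at this
        linarith
      have hDq : D / (1 - Real.exp (-l0)) =
          Real.exp (-l0) * (D / (1 - Real.exp (-l0))) + D := by
        have : 1 - Real.exp (-l0) ≠ 0 := by linarith
        field_simp
        ring
      calc _ ≤ _ := h4
        _ ≤ Real.exp (-l0) * (Real.exp (-l0) ^ N + D / (1 - Real.exp (-l0)) + D) := by gcongr
        _ ≤ Real.exp (-l0) ^ (N + 1) + (Real.exp (-l0) * (D / (1 - Real.exp (-l0))) + D) := by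
          rw [pow_succ]
          nlinarith
        _ = _ := by rw [← hDq]
    · have hlog := abs_log_one_sub_mul_sub_le hq1 hT0 hT1 (Real.exp_pos (-l N)).le
        (Real.exp_le_exp.2 (neg_le_neg (hl N (by lia)))) (Real.exp_pos (-l (N + 1))).le
        (Real.exp_le_exp.2 (neg_le_neg (hl (N + 1) le_rfl)))
      have hlog' : (|t (N + 1) - Real.exp (-l N)| + |Real.exp (-l (N + 1)) - Real.exp (-l N)|) /
          (1 - Real.exp (-l0)) ^ 2 * |Real.exp (-l (N + 1)) - Real.exp (-l N)| ≤
          (Real.exp (-l0) ^ N + D / (1 - Real.exp (-l0)) + D) /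
            (1 - Real.exp (-l0)) ^ 2 * D := by
        have : 0 ≤ Real.exp (-l0) ^ N + D / (1 - Real.exp (-l0)) := (abs_nonneg _).trans ih2
        gcongr
      rw [Finset.sum_range_succ _ (N + 1), Finset.sum_range_succ l (N + 1),
        Finset.sum_range_succ (fun j => (Real.exp (-l0) ^ j + D / (1 - Real.exp (-l0)) + D) /
          (1 - Real.exp (-l0)) ^ 2 * D) N, h5]
      refine le_trans ?_ (add_le_add ih3 (hlog.trans hlog'))
      refine le_trans (le_of_eq ?_) (abs_add_le _ _)
      congr 1
      ring

lemma exists_arcosh_comp_deriv_bounds {p q : ℝ} (hpq : p < q) {g g' g'' : ℝ → ℝ} {M : ℝ}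
    (hg : ∀ x ∈ Set.Icc p q, HasDerivWithinAt g (g' x) (Set.Icc p q) x)
    (hg' : ∀ x ∈ Set.Icc p q, HasDerivWithinAt g' (g'' x) (Set.Icc p q) x)
    (hM : ∀ x ∈ Set.Icc p q, |g'' x| ≤ M) (h2 : ∀ x ∈ Set.Icc p q, 2 < g x) :
    ∃ (L' : ℝ → ℝ) (l0 M1 M2 : ℝ), 0 < l0 ∧
      (∀ x ∈ Set.Icc p q,
        HasDerivWithinAt (fun x => Real.arcosh (g x / 2)) (L' x) (Set.Icc p q) x) ∧
      (∀ x ∈ Set.Icc p q, l0 ≤ Real.arcosh (g x / 2)) ∧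
      (∀ x ∈ Set.Icc p q, |L' x| ≤ M1) ∧
      (∀ x ∈ Set.Icc p q, ∀ y ∈ Set.Icc p q, |L' y - L' x| ≤ M2 * |y - x|) := by
  set φ : ℝ → ℝ := fun z => (√((z / 2) ^ 2 - 1))⁻¹ / 2 with hφ
  have hφc : ContDiffOn ℝ 1 φ (Set.Ioi 2) := by
    intro z hz
    have hz' : (2 : ℝ) < z := hz
    have h : 0 < (z / 2) ^ 2 - 1 := by nlinarith
    have h1 : ContDiffAt ℝ 1 (fun z : ℝ => (z / 2) ^ 2 - 1) z := by fun_prop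
    exact (((h1.sqrt h.ne').inv (Real.sqrt_pos.2 h).ne').div_const 2).contDiffWithinAt
  have hφd : ∀ z ∈ Set.Ioi (2 : ℝ), HasDerivAt φ (deriv φ z) z := fun z hz =>
    ((hφc.contDiffAt (isOpen_Ioi.mem_nhds hz)).differentiableAt one_ne_zero).hasDerivAt
  have hφ'c : ContinuousOn (deriv φ) (Set.Ioi 2) :=
    hφc.continuousOn_deriv_of_isOpen isOpen_Ioi le_rfl
  have hgc : ContinuousOn g (Set.Icc p q) := fun x hx => (hg x hx).continuousWithinAt
  have hg'c : ContinuousOn g' (Set.Icc p q) := fun x hx => (hg' x hx).continuousWithinAt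
  have hmaps : Set.MapsTo g (Set.Icc p q) (Set.Ioi 2) := h2
  have hφg : ContinuousOn (fun x => φ (g x)) (Set.Icc p q) := hφc.continuousOn.comp hgc hmaps
  have hL : ∀ x ∈ Set.Icc p q, HasDerivWithinAt (fun x => Real.arcosh (g x / 2))
      (φ (g x) * g' x) (Set.Icc p q) x := by
    intro x hx
    have h : g x / 2 ∈ Set.Ioi (1 : ℝ) := by
      have := h2 x hx
      simp only [Set.mem_Ioi]; linarith
    refine ((Real.hasDerivAt_arcosh h).comp_hasDerivWithinAt x
      ((hg x hx).div_const 2)).congr_deriv ?_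
    simp only [hφ]
    ring
  have hL' : ∀ x ∈ Set.Icc p q, HasDerivWithinAt (fun x => φ (g x) * g' x)
      (deriv φ (g x) * g' x * g' x + φ (g x) * g'' x) (Set.Icc p q) x := fun x hx =>
    ((hφd _ (h2 x hx)).comp_hasDerivWithinAt x (hg x hx)).mul (hg' x hx)
  obtain ⟨M1, hM1⟩ := isCompact_Icc.exists_bound_of_continuousOn (hφg.mul hg'c)
  obtain ⟨Ma, hMa⟩ := isCompact_Icc.exists_bound_of_continuousOn
    (((hφ'c.comp hgc hmaps).mul hg'c).mul hg'c)
  obtain ⟨Mb, hMb⟩ := isCompact_Icc.exists_bound_of_continuousOn hφg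
  obtain ⟨x0, hx0, hmin⟩ := isCompact_Icc.exists_isMinOn (Set.nonempty_Icc.2 hpq.le)
    (fun x hx => (hL x hx).continuousWithinAt : ContinuousOn _ _)
  refine ⟨fun x => φ (g x) * g' x, Real.arcosh (g x0 / 2), M1, Ma + Mb * M,
    Real.arcosh_pos (by linarith [h2 x0 hx0]), hL, fun x hx => hmin hx, hM1, fun x hx y hy => ?_⟩
  refine (convex_Icc p q).norm_image_sub_le_of_norm_hasDerivWithin_le hL' (fun z hz => ?_) hx hy
  refine (norm_add_le _ _).trans (add_le_add (hMa z hz) ?_)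
  rw [norm_mul]
  exact mul_le_mul (hMb z hz) (hM z hz) (norm_nonneg _) ((norm_nonneg _).trans (hMb z hz))

section
variable {p q M1 M2 : ℝ} {L L' : ℝ → ℝ}

lemma abs_sub_sub_mul_le_of_lipschitz_deriv
    (hL : ∀ x ∈ Set.Icc p q, HasDerivWithinAt L (L' x) (Set.Icc p q) x)
    (hlip : ∀ x ∈ Set.Icc p q, ∀ y ∈ Set.Icc p q, |L' y - L' x| ≤ M2 * |y - x|)
    (hM2 : 0 ≤ M2) {x s : ℝ} (hpx : p ≤ x) (hxs : x ≤ s) (hsq : s ≤ q) :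
    |L s - L x - L' x * (s - x)| ≤ M2 * (s - x) ^ 2 := by
  have hsub : Set.Icc x s ⊆ Set.Icc p q := Set.Icc_subset_Icc hpx hsq
  have hd : ∀ z ∈ Set.Icc x s, HasDerivWithinAt (fun z => L z - L' x * z) (L' z - L' x)
      (Set.Icc x s) z := fun z hz =>
    (((hL z (hsub hz)).mono hsub).sub ((hasDerivWithinAt_id z _).const_mul (L' x))).congr_deriv
      (by simp)
  have hb : ∀ z ∈ Set.Icc x s, ‖L' z - L' x‖ ≤ M2 * (s - x) := fun z hz => by
    refine (hlip x (hsub ⟨le_rfl, hxs⟩) z (hsub hz)).trans ?_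
    rw [abs_of_nonneg (by linarith [hz.1])]
    have := hz.2
    gcongr
  have := (convex_Icc x s).norm_image_sub_le_of_norm_hasDerivWithin_le hd hb
    (Set.left_mem_Icc.2 hxs) (Set.right_mem_Icc.2 hxs)
  rw [Real.norm_eq_abs, Real.norm_eq_abs, abs_of_nonneg (sub_nonneg.2 hxs)] at this
  rw [show L s - L x - L' x * (s - x) = L s - L' x * s - (L x - L' x * x) by ring, sq, ← mul_assoc]
  exact this

lemma intervalIntegrable_of_hasDerivWithinAt_Icc
    (hL : ∀ x ∈ Set.Icc p q, HasDerivWithinAt L (L' x) (Set.Icc p q) x)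
    {a b : ℝ} (ha : a ∈ Set.Icc p q) (hb : b ∈ Set.Icc p q) :
    IntervalIntegrable L MeasureTheory.volume a b := by
  have hc : ContinuousOn L (Set.Icc p q) := fun x hx => (hL x hx).continuousWithinAt
  exact (hc.mono (Set.uIcc_subset_Icc ha hb)).intervalIntegrable

lemma abs_integral_sub_trapezoid_le
    (hL : ∀ x ∈ Set.Icc p q, HasDerivWithinAt L (L' x) (Set.Icc p q) x)
    (hlip : ∀ x ∈ Set.Icc p q, ∀ y ∈ Set.Icc p q, |L' y - L' x| ≤ M2 * |y - x|)
    (hM2 : 0 ≤ M2) {x h : ℝ} (hh : 0 ≤ h) (hpx : p ≤ x) (hxq : x + h ≤ q) :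
    |(∫ s in x..(x + h), L s) - h * ((L x + L (x + h)) / 2)| ≤ 2 * M2 * h ^ 3 := by
  have hLint : IntervalIntegrable L MeasureTheory.volume x (x + h) :=
    intervalIntegrable_of_hasDerivWithinAt_Icc hL ⟨hpx, by linarith⟩ ⟨by linarith, hxq⟩
  have hφ : (∫ s in x..(x + h), (L s - (L x + L' x * (s - x)))) =
      (∫ s in x..(x + h), L s) - (h * L x + L' x * (h ^ 2 / 2)) := by
    rw [intervalIntegral.integral_sub hLint (Continuous.intervalIntegrable (by fun_prop) _ _),
      intervalIntegral.integral_add (by simp) (Continuous.intervalIntegrable (by fun_prop) _ _),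
      intervalIntegral.integral_const_mul,
      intervalIntegral.integral_sub (by simp) (by simp), integral_id]
    simp
    ring_nf
    simp only [true_or]
  have h1 : ‖∫ s in x..(x + h), (L s - (L x + L' x * (s - x)))‖ ≤ M2 * h ^ 2 * |x + h - x| := by
    refine intervalIntegral.norm_integral_le_of_norm_le_const fun s hs => ?_
    rw [Set.uIoc_of_le (by linarith)] at hs
    have := abs_sub_sub_mul_le_of_lipschitz_deriv hL hlip hM2 hpx hs.1.le (hs.2.trans hxq)
    rw [Real.norm_eq_abs, ← sub_sub]
    refine this.trans ?_
    have h1 := hs.1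
    have h2 := hs.2
    have h3 : s - x ≤ h := by linarith
    have h4 : 0 ≤ s - x := by linarith
    gcongr
  have h2 := abs_sub_sub_mul_le_of_lipschitz_deriv hL hlip hM2 hpx (by linarith : x ≤ x + h) hxq
  rw [add_sub_cancel_left] at h1 h2
  rw [abs_of_nonneg hh, Real.norm_eq_abs] at h1
  have h3 : (∫ s in x..(x + h), L s) - h * ((L x + L (x + h)) / 2) =
      (∫ s in x..(x + h), (L s - (L x + L' x * (s - x)))) -
        h / 2 * (L (x + h) - L x - L' x * h) := by
    rw [hφ]; ring
  rw [h3]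
  refine (abs_sub _ _).trans ?_
  rw [abs_mul, abs_of_nonneg (by linarith : 0 ≤ h / 2)]
  have h4 : h / 2 * |L (x + h) - L x - L' x * h| ≤ h / 2 * (M2 * h ^ 2) := by gcongr
  have h5 : 0 ≤ M2 * h ^ 3 := by positivity
  nlinarith

lemma abs_sum_sub_integral_le
    (hL : ∀ x ∈ Set.Icc p q, HasDerivWithinAt L (L' x) (Set.Icc p q) x)
    (hlip : ∀ x ∈ Set.Icc p q, ∀ y ∈ Set.Icc p q, |L' y - L' x| ≤ M2 * |y - x|)
    (hM2 : 0 ≤ M2) {y h : ℝ} (hh : 0 < h) (hpy : p ≤ y) (N : ℕ) (hyq : y + N * h ≤ q) :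
    |∑ j ∈ Finset.range (N + 1), L (y + j * h) -
        (h⁻¹ * (∫ s in y..(y + N * h), L s) + (L y + L (y + N * h)) / 2)| ≤
      N * (2 * M2 * h ^ 2) := by
  induction N with
  | zero => simp
  | succ N ih =>
    have hN : (0 : ℝ) ≤ N * h := by positivity
    have heq : y + ((N + 1 : ℕ) : ℝ) * h = y + N * h + h := by push_cast; ring
    rw [heq] at hyq ⊢
    have ih' := ih (by linarith)
    have hm : y + N * h ∈ Set.Icc p q := ⟨by linarith, by linarith⟩
    have htrap := abs_integral_sub_trapezoid_le hL hlip hM2 hh.le hm.1 hyq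
    have hLint := intervalIntegral.integral_add_adjacent_intervals
      (intervalIntegrable_of_hasDerivWithinAt_Icc hL (a := y) ⟨hpy, by linarith⟩ hm)
      (intervalIntegrable_of_hasDerivWithinAt_Icc hL hm (b := y + N * h + h)
        ⟨by linarith, hyq⟩)
    have htrap' : |h⁻¹ * (∫ s in (y + N * h)..(y + N * h + h), L s) -
        (L (y + N * h) + L (y + N * h + h)) / 2| ≤ 2 * M2 * h ^ 2 := by
      have : h⁻¹ * (∫ s in (y + N * h)..(y + N * h + h), L s) -
          (L (y + N * h) + L (y + N * h + h)) / 2 =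
          h⁻¹ * ((∫ s in (y + N * h)..(y + N * h + h), L s) -
          h * ((L (y + N * h) + L (y + N * h + h)) / 2)) := by
        field_simp
      rw [this, abs_mul, abs_of_pos (inv_pos.2 hh), inv_mul_le_iff₀ hh]
      linarith
    rw [Finset.sum_range_succ, ← hLint, heq]
    have : ((N + 1 : ℕ) : ℝ) * (2 * M2 * h ^ 2) = N * (2 * M2 * h ^ 2) + 2 * M2 * h ^ 2 := by
      push_cast; ring
    rw [this]
    refine le_trans ?_ (add_le_add ih' htrap')
    refine le_trans (le_of_eq ?_) (abs_sub _ _)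
    congr 1
    ring

lemma abs_integral_sub_mul_le
    (hL : ∀ x ∈ Set.Icc p q, HasDerivWithinAt L (L' x) (Set.Icc p q) x)
    (hM1 : ∀ x ∈ Set.Icc p q, |L' x| ≤ M1) {a b z : ℝ} (hpa : p ≤ a) (hbq : b ≤ q)
    (haz : a ≤ z) (hzb : z ≤ b) :
    |(∫ s in a..b, L s) - (b - a) * L z| ≤ M1 * (b - a) ^ 2 := by
  have hab := haz.trans hzb
  have hz : z ∈ Set.Icc p q := ⟨hpa.trans haz, hzb.trans hbq⟩
  have hM10 : 0 ≤ M1 := (abs_nonneg _).trans (hM1 z hz)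
  have hLint : IntervalIntegrable L MeasureTheory.volume a b :=
    intervalIntegrable_of_hasDerivWithinAt_Icc hL ⟨hpa, hab.trans hbq⟩ ⟨hpa.trans hab, hbq⟩
  have h1 : (∫ s in a..b, L s) - (b - a) * L z = ∫ s in a..b, (L s - L z) := by
    rw [intervalIntegral.integral_sub hLint (by simp)]
    simp
  rw [h1]
  have h2 : ‖∫ s in a..b, (L s - L z)‖ ≤ M1 * (b - a) * |b - a| := by
    refine intervalIntegral.norm_integral_le_of_norm_le_const fun s hs => ?_
    rw [Set.uIoc_of_le hab] at hs
    refine ((convex_Icc p q).norm_image_sub_le_of_norm_hasDerivWithin_le hL hM1 hz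
      ⟨hpa.trans hs.1.le, hs.2.trans hbq⟩).trans ?_
    gcongr
    rw [Real.norm_eq_abs, abs_le]
    constructor <;> linarith [hs.1, hs.2]
  rw [abs_of_nonneg (sub_nonneg.2 hab)] at h2
  rw [Real.norm_eq_abs] at h2
  linarith [h2]
end

lemma frequently_fract_mem_Ioo {c : ℝ} (hc : Irrational c) {a b : ℝ} (ha : 0 ≤ a) (hb : b ≤ 1)
    (hab : a < b) : ∃ᶠ n : ℕ in atTop, Int.fract ((n : ℝ) * c) ∈ Set.Ioo a b := by
  have hdense : DenseRange (· • (c : AddCircle (1 : ℝ)) : ℤ → AddCircle (1 : ℝ)) :=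
    AddCircle.denseRange_zsmul_coe_iff.2 (by simpa using hc)
  have hcl : MapClusterPt (((a + b) / 2 : ℝ) : AddCircle (1 : ℝ)) atTop
      (· • (c : AddCircle (1 : ℝ)) : ℕ → AddCircle (1 : ℝ)) := by
    rw [mapClusterPt_atTop_nsmul_iff_mem_topologicalClosure_zmultiples]
    exact hdense _
  have hopen : IsOpen ((fun x : ℝ => (x : AddCircle (1 : ℝ))) '' Set.Ioo a b) :=
    QuotientAddGroup.isOpenMap_coe _ isOpen_Ioo
  have hmem : (((a + b) / 2 : ℝ) : AddCircle (1 : ℝ)) ∈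
      (fun x : ℝ => (x : AddCircle (1 : ℝ))) '' Set.Ioo a b :=
    ⟨_, ⟨by linarith, by linarith⟩, rfl⟩
  refine (hcl.frequently (hopen.mem_nhds hmem)).mono ?_
  rintro n ⟨x, hx, hxn⟩
  have hxn' : (x : AddCircle (1 : ℝ)) = ((Int.fract (n * c : ℝ) : ℝ) : AddCircle (1 : ℝ)) := by
    rw [AddCircle.coe_fract, ← nsmul_eq_mul, AddCircle.coe_nsmul]; exact hxn
  have := (AddCircle.coe_eq_coe_iff_of_mem_Ico (p := (1 : ℝ)) (a := 0)
    ⟨ha.trans hx.1.le, by linarith [hx.2]⟩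
    ⟨Int.fract_nonneg _, by simpa using Int.fract_lt_one _⟩).1 hxn'
  exact this ▸ hx

lemma frequently_max_sub_lt_fract_mul_add {c : ℝ} (hc : Irrational c) (l : ℝ) {e : ℕ → ℝ}
    (he : Tendsto e atTop (𝓝 0)) {η : ℝ} (hη : 0 < η) :
    ∃ᶠ n : ℕ in atTop, max 0 l - η < Int.fract ((n : ℝ) * c) * l + e n := by
  have hle : ∀ᶠ n in atTop, -(η / 2) < e n := he.eventually_const_lt (by linarith)
  set d := η / 2 / (|l| + η) with hd
  have hden : 0 < |l| + η := by positivity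
  have hd0 : 0 < d := by positivity
  have hdl : d * |l| < η / 2 := by
    rw [hd, div_mul_eq_mul_div, div_lt_iff₀ hden]
    nlinarith [abs_nonneg l]
  have hd1 : d < 1 := by
    rw [hd, div_lt_one hden]
    linarith [abs_nonneg l]
  rcases le_total 0 l with hl | hl
  · rw [abs_of_nonneg hl] at hdl
    refine ((frequently_fract_mem_Ioo hc (a := 1 - d) (b := 1) (by linarith) le_rfl
      (by linarith)).and_eventually hle).mono ?_
    rintro n ⟨h, h'⟩
    rw [max_eq_right hl]
    nlinarith [h.1]
  · rw [abs_of_nonpos hl] at hdl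
    refine ((frequently_fract_mem_Ioo hc (a := 0) (b := d) le_rfl hd1.le hd0).and_eventually
      hle).mono ?_
    rintro n ⟨h, h'⟩
    rw [max_eq_left hl]
    nlinarith [h.2]

lemma eventually_fract_mul_add_lt_max_add (c l : ℝ) {e : ℕ → ℝ}
    (he : Tendsto e atTop (𝓝 0)) {η : ℝ} (hη : 0 < η) :
    ∀ᶠ n : ℕ in atTop, Int.fract ((n : ℝ) * c) * l + e n < max 0 l + η := by
  filter_upwards [he.eventually_lt_const hη] with n hn
  have h0 := Int.fract_nonneg ((n : ℝ) * c)
  have h1 := (Int.fract_lt_one ((n : ℝ) * c)).le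
  have : Int.fract ((n : ℝ) * c) * l ≤ max 0 l := by
    rcases le_total 0 l with hl | hl
    · rw [max_eq_right hl]; nlinarith
    · rw [max_eq_left hl]; nlinarith
  linarith

lemma limsup_eq_of_forall {u : ℕ → ℝ} {A : ℝ} (h1 : ∀ y, A < y → ∀ᶠ n in atTop, u n < y)
    (h2 : ∀ y, y < A → ∃ᶠ n in atTop, y < u n) : limsup u atTop = A := by
  have hbdd : IsBoundedUnder (· ≤ ·) atTop u :=
    isBoundedUnder_of_eventually_le ((h1 (A + 1) (by linarith)).mono fun _ h => h.le)
  have hco : IsCoboundedUnder (· ≤ ·) atTop u :=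
    IsCoboundedUnder.of_frequently_ge ((h2 (A - 1) (by linarith)).mono fun _ h => h.le)
  refine le_antisymm (le_of_forall_gt_imp_ge_of_dense fun y hy => ?_)
    (le_of_forall_lt_imp_le_of_dense fun y hy => ?_)
  · exact limsup_le_of_le hco ((h1 y hy).mono fun _ h => h.le)
  · exact le_limsup_of_frequently_le ((h2 y hy).mono fun _ h => h.le) hbdd

lemma liminf_eq_of_forall {u : ℕ → ℝ} {A : ℝ} (h1 : ∀ y, y < A → ∀ᶠ n in atTop, y < u n)
    (h2 : ∀ y, A < y → ∃ᶠ n in atTop, u n < y) : liminf u atTop = A := by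
  have hbdd : IsBoundedUnder (· ≥ ·) atTop u :=
    isBoundedUnder_of_eventually_ge ((h1 (A - 1) (by linarith)).mono fun _ h => h.le)
  have hco : IsCoboundedUnder (· ≥ ·) atTop u :=
    IsCoboundedUnder.of_frequently_le ((h2 (A + 1) (by linarith)).mono fun _ h => h.le)
  refine le_antisymm (le_of_forall_gt_imp_ge_of_dense fun y hy => ?_)
    (le_of_forall_lt_imp_le_of_dense fun y hy => ?_)
  · exact liminf_le_of_frequently_le ((h2 y hy).mono fun _ h => h.le) hbdd
  · exact le_liminf_of_le hco ((h1 y hy).mono fun _ h => h.le)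

lemma limsup_exp_fract_mul_add {c : ℝ} (hc : Irrational c) (k l : ℝ) {e : ℕ → ℝ}
    (he : Tendsto e atTop (𝓝 0)) :
    limsup (fun n : ℕ => Real.exp (k + (Int.fract ((n : ℝ) * c) * l + e n))) atTop =
      Real.exp k * max 1 (Real.exp l) := by
  have hmax : Real.exp k * max 1 (Real.exp l) = Real.exp (k + max 0 l) := by
    rw [Real.exp_add, Real.exp_monotone.map_max, Real.exp_zero]
  rw [hmax]
  refine limsup_eq_of_forall (fun y hy => ?_) fun y hy => ?_
  · have hy0 : 0 < y := (Real.exp_pos _).trans hy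
    rw [← Real.lt_log_iff_exp_lt hy0] at hy
    filter_upwards [eventually_fract_mul_add_lt_max_add c l he (sub_pos.2 hy)] with n hn
    rw [← Real.lt_log_iff_exp_lt hy0]
    linarith
  · rcases le_or_gt y 0 with hy0 | hy0
    · exact Frequently.of_forall fun n => hy0.trans_lt (Real.exp_pos _)
    · rw [← Real.log_lt_iff_lt_exp hy0] at hy
      refine (frequently_max_sub_lt_fract_mul_add hc l he (sub_pos.2 hy)).mono fun n hn => ?_
      rw [← Real.log_lt_iff_lt_exp hy0]
      linarith

lemma liminf_exp_fract_mul_add {c : ℝ} (hc : Irrational c) (k l : ℝ) {e : ℕ → ℝ}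
    (he : Tendsto e atTop (𝓝 0)) :
    liminf (fun n : ℕ => Real.exp (k + (Int.fract ((n : ℝ) * c) * l + e n))) atTop =
      Real.exp k * min 1 (Real.exp l) := by
  have hmin : Real.exp k * min 1 (Real.exp l) = Real.exp (k + min 0 l) := by
    rw [Real.exp_add, Real.exp_monotone.map_min, Real.exp_zero]
  have he' : Tendsto (fun n => -e n) atTop (𝓝 0) := by simpa using he.neg
  have hneg : max 0 (-l) = -min 0 l := by
    rw [← max_neg_neg, neg_zero]
  rw [hmin]
  refine liminf_eq_of_forall (fun y hy => ?_) fun y hy => ?_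
  · rcases le_or_gt y 0 with hy0 | hy0
    · exact Eventually.of_forall fun n => hy0.trans_lt (Real.exp_pos _)
    · rw [← Real.log_lt_iff_lt_exp hy0] at hy
      filter_upwards [eventually_fract_mul_add_lt_max_add c (-l) he' (sub_pos.2 hy)] with n hn
      rw [← Real.log_lt_iff_lt_exp hy0]
      linarith
  · have hy0 : 0 < y := (Real.exp_pos _).trans hy
    rw [← Real.lt_log_iff_exp_lt hy0] at hy
    refine (frequently_max_sub_lt_fract_mul_add hc (-l) he' (sub_pos.2 hy)).mono fun n hn => ?_
    rw [← Real.lt_log_iff_exp_lt hy0]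
    linarith

lemma sum_error_bound {Q D : ℝ} (hQ0 : 0 ≤ Q) (hQ1 : Q < 1) (hD : 0 ≤ D) (N : ℕ) :
    ∑ j ∈ Finset.range N, (Q ^ j + D / (1 - Q) + D) / (1 - Q) ^ 2 * D ≤
      ((1 - Q)⁻¹ + N * D * ((1 - Q)⁻¹ + 1)) / (1 - Q) ^ 2 * D := by
  rw [← Finset.sum_mul, ← Finset.sum_div]
  have hgeom : ∑ j ∈ Finset.range N, Q ^ j ≤ (1 - Q)⁻¹ := by
    rw [← tsum_geometric_of_lt_one hQ0 hQ1]
    exact (summable_geometric_of_lt_one hQ0 hQ1).sum_le_tsum _ fun _ _ => by positivity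
  have hsum : ∑ j ∈ Finset.range N, (Q ^ j + D / (1 - Q) + D) ≤
      (1 - Q)⁻¹ + N * D * ((1 - Q)⁻¹ + 1) := by
    simp only [Finset.sum_add_distrib, Finset.sum_const, Finset.card_range, nsmul_eq_mul]
    have : (N : ℝ) * D * ((1 - Q)⁻¹ + 1) = N * (D / (1 - Q)) + N * D := by ring
    linarith
  gcongr

lemma segment_estimate {p q l0 M1 M2 : ℝ} {L L' : ℝ → ℝ} (hpq : p ≤ q)
    (hL : ∀ x ∈ Set.Icc p q, HasDerivWithinAt L (L' x) (Set.Icc p q) x)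
    (hl0 : 0 < l0) (hl : ∀ x ∈ Set.Icc p q, l0 ≤ L x) (hM1 : ∀ x ∈ Set.Icc p q, |L' x| ≤ M1)
    (hlip : ∀ x ∈ Set.Icc p q, ∀ y ∈ Set.Icc p q, |L' y - L' x| ≤ M2 * |y - x|)
    (hM2 : 0 ≤ M2) :
    ∃ K, ∀ (h y : ℝ) (N : ℕ) (t : ℕ → ℝ), 0 < h → p ≤ y → y + N * h ≤ q → 0 ≤ t 0 → t 0 ≤ 1 →
      (∀ j ≤ N, t (j + 1) = (2 * Real.cosh (L (y + j * h)) - t j)⁻¹) →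
      (∀ j ≤ N + 1, 0 ≤ t j ∧ t j ≤ 1) ∧
      |t (N + 1) - Real.exp (-L (y + N * h))| ≤ Real.exp (-l0) ^ N + K * h ∧
      |∑ j ∈ Finset.range (N + 1), -Real.log (t (j + 1)) -
        (h⁻¹ * (∫ s in y..(y + N * h), L s) + (L y + L (y + N * h)) / 2 +
          Real.log (1 - Real.exp (-L y) * t 0) -
          Real.log (1 - Real.exp (-L (y + N * h)) * t (N + 1)) +
          (Real.log (1 - Real.exp (-L (y + N * h)) ^ 2) / 2 -
            Real.log (1 - Real.exp (-L y) ^ 2) / 2))| ≤ K * h := by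
  have hM10 : 0 ≤ M1 := (abs_nonneg _).trans (hM1 p ⟨le_rfl, hpq⟩)
  set Q := Real.exp (-l0) with hQ
  have hQ0 : 0 < Q := Real.exp_pos _
  have hQ1 : Q < 1 := Real.exp_lt_one_iff.2 (by linarith)
  have hQ' : 0 < 1 - Q := by linarith
  set K1 := M1 / (1 - Q)
  set K2 := ((1 - Q)⁻¹ + (q - p) * M1 * ((1 - Q)⁻¹ + 1)) / (1 - Q) ^ 2 * M1
  set K3 := (q - p) * (2 * M2)
  have hqp : 0 ≤ q - p := by linarith
  have hK1 : 0 ≤ K1 := by positivity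
  have hK2 : 0 ≤ K2 := by positivity
  have hK3 : 0 ≤ K3 := by positivity
  refine ⟨K1 + K2 + K3, fun h y N t hh hpy hyq ht0 ht1 ht => ?_⟩
  have hmem : ∀ j : ℕ, j ≤ N → y + j * h ∈ Set.Icc p q := fun j hj => by
    have h1 : (0 : ℝ) ≤ j * h := by positivity
    have h2 : (j : ℝ) * h ≤ N * h := by gcongr
    exact ⟨by linarith, by linarith⟩
  have hNh : N * h ≤ q - p := by linarith
  have hvar : ∀ j < N, |L (y + ((j + 1 : ℕ) : ℝ) * h) - L (y + j * h)| ≤ M1 * h := by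
    intro j hj
    have := (convex_Icc p q).norm_image_sub_le_of_norm_hasDerivWithin_le hL hM1
      (hmem j hj.le) (hmem (j + 1) hj)
    refine this.trans (le_of_eq ?_)
    congr 1
    rw [Real.norm_eq_abs, show y + ((j + 1 : ℕ) : ℝ) * h - (y + j * h) = h by push_cast; ring,
      abs_of_pos hh]
  obtain ⟨h1, h2, h3⟩ := riccati_sum_estimate (l := fun j => L (y + j * h)) hl0
    (mul_nonneg hM10 hh.le) N (fun j hj => hl _ (hmem j hj)) hvar ht0 ht1 ht
  have h4 := abs_sum_sub_integral_le hL hlip hM2 hh hpy N hyq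
  refine ⟨h1, h2.trans ?_, ?_⟩
  · have : M1 * h / (1 - Q) = K1 * h := by ring
    rw [this]
    nlinarith
  · have h5 : ∑ j ∈ Finset.range N, (Q ^ j + M1 * h / (1 - Q) + M1 * h) / (1 - Q) ^ 2 * (M1 * h) ≤
        K2 * h := by
      refine (sum_error_bound hQ0.le hQ1 (mul_nonneg hM10 hh.le) N).trans ?_
      have : N * (M1 * h) ≤ (q - p) * M1 := by nlinarith
      calc _ ≤ ((1 - Q)⁻¹ + (q - p) * M1 * ((1 - Q)⁻¹ + 1)) / (1 - Q) ^ 2 * (M1 * h) := by gcongr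
        _ = _ := by ring
    have h6 : N * (2 * M2 * h ^ 2) ≤ K3 * h := by
      have : N * (2 * M2 * h ^ 2) = N * h * (2 * M2) * h := by ring
      rw [this]
      exact mul_le_mul_of_nonneg_right (mul_le_mul_of_nonneg_right hNh (by positivity)) hh.le
    simp only [Nat.cast_zero, zero_mul, add_zero] at h3
    have h7 : 0 ≤ K1 * h := by positivity
    calc _ ≤ _ := (le_of_eq ?_).trans (abs_add_le _ _)
      _ ≤ K2 * h + K3 * h := add_le_add (h3.trans h5) (h4.trans h6)
      _ ≤ _ := by linarith
    congr 1
    ring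

/-- Asymptotics of the product of the solutions of a Riccati recurrence along one interval of
smoothness of the symbol `2 * cosh L`. -/
lemma segment_tendsto {p q l0 M1 M2 τ : ℝ} {L L' : ℝ → ℝ} (hpq : p < q)
    (hL : ∀ x ∈ Set.Icc p q, HasDerivWithinAt L (L' x) (Set.Icc p q) x)
    (hl0 : 0 < l0) (hl : ∀ x ∈ Set.Icc p q, l0 ≤ L x) (hM1 : ∀ x ∈ Set.Icc p q, |L' x| ≤ M1)
    (hlip : ∀ x ∈ Set.Icc p q, ∀ y ∈ Set.Icc p q, |L' y - L' x| ≤ M2 * |y - x|)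
    (hM2 : 0 ≤ M2) {N : ℕ → ℕ} {y : ℕ → ℝ} {T : ℕ → ℕ → ℝ}
    (hy : ∀ᶠ n : ℕ in atTop, p ≤ y n ∧ y n ≤ p + (n : ℝ)⁻¹)
    (hN : ∀ᶠ n : ℕ in atTop, q - (n : ℝ)⁻¹ ≤ y n + N n * (n : ℝ)⁻¹ ∧ y n + N n * (n : ℝ)⁻¹ ≤ q)
    (hT : ∀ᶠ n : ℕ in atTop, 0 ≤ T n 0 ∧ T n 0 ≤ 1 ∧
      ∀ j ≤ N n, T n (j + 1) = (2 * Real.cosh (L (y n + j * (n : ℝ)⁻¹)) - T n j)⁻¹)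
    (hτ1 : τ ≤ 1) (hτ : Tendsto (fun n => T n 0) atTop (𝓝 τ)) :
    (∀ᶠ n in atTop, ∀ j ≤ N n + 1, 0 ≤ T n j ∧ T n j ≤ 1) ∧
    Tendsto (fun n => T n (N n + 1)) atTop (𝓝 (Real.exp (-L q))) ∧
    Tendsto (fun n : ℕ => ∑ j ∈ Finset.range (N n + 1), -Real.log (T n (j + 1)) -
        n * (∫ s in p..q, L s) + n * (y n - p) * L p + n * (q - (y n + N n * (n : ℝ)⁻¹)) * L q)
      atTop (𝓝 ((L p + L q) / 2 + Real.log (1 - Real.exp (-L p) * τ) -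
        Real.log (1 - Real.exp (-L q) ^ 2) / 2 - Real.log (1 - Real.exp (-L p) ^ 2) / 2)) := by
  obtain ⟨K, hK⟩ := segment_estimate hpq.le hL hl0 hl hM1 hlip hM2
  have hp : p ∈ Set.Icc p q := ⟨le_rfl, hpq.le⟩
  have hq : q ∈ Set.Icc p q := ⟨hpq.le, le_rfl⟩
  have hM10 : 0 ≤ M1 := (abs_nonneg _).trans (hM1 p hp)
  have hinv : Tendsto (fun n : ℕ => (n : ℝ)⁻¹) atTop (𝓝 0) := tendsto_inv_atTop_nhds_zero_nat
  have hylim : Tendsto y atTop (𝓝 p) :=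
    tendsto_of_tendsto_of_tendsto_of_le_of_le' tendsto_const_nhds
      (by simpa using hinv.const_add p) (hy.mono fun _ h => h.1) (hy.mono fun _ h => h.2)
  set z : ℕ → ℝ := fun n => y n + N n * (n : ℝ)⁻¹ with hz
  have hzlim : Tendsto z atTop (𝓝 q) :=
    tendsto_of_tendsto_of_tendsto_of_le_of_le' (by simpa using hinv.const_sub q)
      tendsto_const_nhds (hN.mono fun _ h => h.1) (hN.mono fun _ h => h.2)
  have hpos : ∀ᶠ n : ℕ in atTop, (0 : ℝ) < (n : ℝ)⁻¹ := by
    filter_upwards [eventually_gt_atTop 0] with n hn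
    positivity
  have hymem : ∀ᶠ n in atTop, y n ∈ Set.Icc p q := by
    filter_upwards [hy, hN, hpos] with n h1 h2 h3
    have : (0 : ℝ) ≤ N n * (n : ℝ)⁻¹ := by positivity
    exact ⟨h1.1, by linarith⟩
  have hzmem : ∀ᶠ n in atTop, z n ∈ Set.Icc p q := by
    filter_upwards [hy, hN, hpos] with n h1 h2 h3
    have : (0 : ℝ) ≤ N n * (n : ℝ)⁻¹ := by positivity
    exact ⟨by simp only [hz]; linarith, h2.2⟩
  have hLc : ContinuousOn L (Set.Icc p q) := fun x hx => (hL x hx).continuousWithinAt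
  have hLy : Tendsto (fun n => L (y n)) atTop (𝓝 (L p)) :=
    (hLc p hp).tendsto.comp (tendsto_nhdsWithin_iff.2 ⟨hylim, hymem⟩)
  have hLz : Tendsto (fun n => L (z n)) atTop (𝓝 (L q)) :=
    (hLc q hq).tendsto.comp (tendsto_nhdsWithin_iff.2 ⟨hzlim, hzmem⟩)
  have hNlim : Tendsto N atTop atTop := by
    have h1 : Tendsto (fun n : ℕ => (z n - y n) * (n : ℝ)) atTop atTop :=
      (hzlim.sub hylim).pos_mul_atTop (by linarith) tendsto_natCast_atTop_atTop
    have h2 : Tendsto (fun n : ℕ => (N n : ℝ)) atTop atTop := by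
      refine h1.congr' ?_
      filter_upwards [eventually_gt_atTop 0] with n hn
      simp only [hz]
      field_simp
      ring
    exact tendsto_natCast_atTop_iff.1 h2
  have hest := (hy.and (hN.and (hT.and hpos))).mono fun n h =>
    hK (n : ℝ)⁻¹ (y n) (N n) (T n) h.2.2.2 h.1.1 h.2.1.2 h.2.2.1.1 h.2.2.1.2.1 h.2.2.1.2.2
  have hQ : Tendsto (fun n => Real.exp (-l0) ^ N n + K * (n : ℝ)⁻¹) atTop (𝓝 0) := by
    simpa using ((tendsto_pow_atTop_nhds_zero_of_lt_one (Real.exp_pos _).le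
      (Real.exp_lt_one_iff.2 (by linarith : -l0 < 0))).comp hNlim).add (hinv.const_mul K)
  have hμz : Tendsto (fun n => Real.exp (-L (z n))) atTop (𝓝 (Real.exp (-L q))) :=
    (Real.continuous_exp.tendsto _).comp hLz.neg
  have hμy : Tendsto (fun n => Real.exp (-L (y n))) atTop (𝓝 (Real.exp (-L p))) :=
    (Real.continuous_exp.tendsto _).comp hLy.neg
  have hend : Tendsto (fun n => T n (N n + 1)) atTop (𝓝 (Real.exp (-L q))) := by
    have : Tendsto (fun n => T n (N n + 1) - Real.exp (-L (z n))) atTop (𝓝 0) :=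
      squeeze_zero_norm' (hest.mono fun n h => h.2.1) hQ
    simpa using this.add hμz
  refine ⟨hest.mono fun n h => h.1, hend, ?_⟩
  have hμp1 : Real.exp (-L p) < 1 := Real.exp_lt_one_iff.2 (by linarith [hl p hp])
  have hμq1 : Real.exp (-L q) < 1 := Real.exp_lt_one_iff.2 (by linarith [hl q hq])
  have hμp0 := Real.exp_pos (-L p)
  have hμq0 := Real.exp_pos (-L q)
  have herr : Tendsto (fun n : ℕ => ∑ j ∈ Finset.range (N n + 1), -Real.log (T n (j + 1)) -
      ((n : ℝ)⁻¹⁻¹ * (∫ s in y n..z n, L s) + (L (y n) + L (z n)) / 2 +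
        Real.log (1 - Real.exp (-L (y n)) * T n 0) -
        Real.log (1 - Real.exp (-L (z n)) * T n (N n + 1)) +
        (Real.log (1 - Real.exp (-L (z n)) ^ 2) / 2 -
          Real.log (1 - Real.exp (-L (y n)) ^ 2) / 2))) atTop (𝓝 0) :=
    squeeze_zero_norm' (hest.mono fun n h => h.2.2) (by simpa using hinv.const_mul K)
  have hmain : Tendsto (fun n : ℕ => (L (y n) + L (z n)) / 2 +
        Real.log (1 - Real.exp (-L (y n)) * T n 0) -
        Real.log (1 - Real.exp (-L (z n)) * T n (N n + 1)) +
        (Real.log (1 - Real.exp (-L (z n)) ^ 2) / 2 -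
          Real.log (1 - Real.exp (-L (y n)) ^ 2) / 2)) atTop
      (𝓝 ((L p + L q) / 2 + Real.log (1 - Real.exp (-L p) * τ) -
        Real.log (1 - Real.exp (-L q) * Real.exp (-L q)) +
        (Real.log (1 - Real.exp (-L q) ^ 2) / 2 - Real.log (1 - Real.exp (-L p) ^ 2) / 2))) := by
    refine ((((hLy.add hLz).div_const 2).add (((hμy.mul hτ).const_sub 1).log ?_)).sub
      (((hμz.mul hend).const_sub 1).log ?_)).add
      (((((hμz.pow 2).const_sub 1).log ?_).div_const 2).sub
        ((((hμy.pow 2).const_sub 1).log ?_).div_const 2)) <;> nlinarith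
  have hbdry : ∀ a b w : ℕ → ℝ, (∀ᶠ n : ℕ in atTop, p ≤ a n ∧ b n ≤ q ∧ a n ≤ w n ∧ w n ≤ b n ∧
      b n - a n ≤ (n : ℝ)⁻¹) → Tendsto (fun n : ℕ => n * (∫ s in a n..b n, L s) -
        n * (b n - a n) * L (w n)) atTop (𝓝 0) := by
    intro a b w hab
    refine squeeze_zero_norm' (a := fun n : ℕ => M1 * (n : ℝ)⁻¹) ?_
      (by simpa using hinv.const_mul M1)
    filter_upwards [hab, hpos] with n ⟨h1, h2, h3, h4, h5⟩ h6
    have hn : (0 : ℝ) < n := inv_pos.1 h6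
    rw [mul_assoc, ← mul_sub, Real.norm_eq_abs, abs_mul, abs_of_pos hn]
    calc (n : ℝ) * _ ≤ n * (M1 * (b n - a n) ^ 2) := by
          gcongr
          exact abs_integral_sub_mul_le hL hM1 h1 h2 h3 h4
      _ ≤ n * (M1 * (n : ℝ)⁻¹ ^ 2) := by
          have : 0 ≤ b n - a n := by linarith
          gcongr
      _ = M1 * (n : ℝ)⁻¹ := by field_simp
  have hb1 := hbdry (fun _ => p) y (fun _ => p) (by
    filter_upwards [hy, hymem] with n h1 h2
    exact ⟨le_rfl, h2.2, le_rfl, h1.1, by linarith⟩)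
  have hb2 := hbdry z (fun _ => q) (fun _ => q) (by
    filter_upwards [hN, hzmem] with n h1 h2
    exact ⟨h2.1, le_rfl, h1.2, le_rfl, by simp only [hz]; linarith⟩)
  have hall := ((herr.add hmain).sub hb1).sub hb2
  have hlim : ∀ a b c d : ℝ, 0 + (a + b - c + (c / 2 - d)) - 0 - 0 = a + b - c / 2 - d := by
    intros; ring
  rw [← sq, hlim] at hall
  refine hall.congr' ?_
  filter_upwards [hymem, hzmem] with n h1 h2
  have hi1 := intervalIntegral.integral_add_adjacent_intervals
    (intervalIntegrable_of_hasDerivWithinAt_Icc hL hp h1)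
    (intervalIntegrable_of_hasDerivWithinAt_Icc hL h1 h2)
  have hi2 := intervalIntegral.integral_add_adjacent_intervals
    (intervalIntegrable_of_hasDerivWithinAt_Icc hL hp h2)
    (intervalIntegrable_of_hasDerivWithinAt_Icc hL h2 hq)
  rw [← hi2, ← hi1, inv_inv]
  ring

/-- Asymptotics of the product of the solutions of a Riccati recurrence whose symbol is
`2 * cosh L₀` up to the point `c` and `2 * cosh L₁` after it. -/
lemma jump_tendsto {c l0 l1 M01 M02 M11 M12 : ℝ} {L0 L0' L1 L1' : ℝ → ℝ}
    (hc0 : 0 < c) (hc1 : c < 1)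
    (hL0 : ∀ x ∈ Set.Icc 0 c, HasDerivWithinAt L0 (L0' x) (Set.Icc 0 c) x)
    (hl0 : 0 < l0) (hl0' : ∀ x ∈ Set.Icc 0 c, l0 ≤ L0 x)
    (hM01 : ∀ x ∈ Set.Icc 0 c, |L0' x| ≤ M01)
    (hlip0 : ∀ x ∈ Set.Icc 0 c, ∀ y ∈ Set.Icc 0 c, |L0' y - L0' x| ≤ M02 * |y - x|)
    (hL1 : ∀ x ∈ Set.Icc c 1, HasDerivWithinAt L1 (L1' x) (Set.Icc c 1) x)
    (hl1 : 0 < l1) (hl1' : ∀ x ∈ Set.Icc c 1, l1 ≤ L1 x)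
    (hM11 : ∀ x ∈ Set.Icc c 1, |L1' x| ≤ M11)
    (hlip1 : ∀ x ∈ Set.Icc c 1, ∀ y ∈ Set.Icc c 1, |L1' y - L1' x| ≤ M12 * |y - x|)
    {T : ℕ → ℕ → ℝ} (hT : ∀ n, T n 0 = 0)
    (hT0 : ∀ n j : ℕ, 0 < n → ((j : ℝ) + 1) / n ≤ c →
      T n (j + 1) = (2 * Real.cosh (L0 (((j : ℝ) + 1) / n)) - T n j)⁻¹)
    (hT1 : ∀ n j : ℕ, 0 < n → c < ((j : ℝ) + 1) / n → ((j : ℝ) + 1) / n ≤ 1 →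
      T n (j + 1) = (2 * Real.cosh (L1 (((j : ℝ) + 1) / n)) - T n j)⁻¹) :
    (∀ᶠ n in atTop, ∀ j ≤ n, 0 ≤ T n j ∧ T n j ≤ 1) ∧
    Tendsto (fun n : ℕ => ∑ j ∈ Finset.range n, -Real.log (T n (j + 1)) -
        n * ((∫ s in (0 : ℝ)..c, L0 s) + ∫ s in c..1, L1 s) -
        Int.fract ((n : ℝ) * c) * (L1 c - L0 c)) atTop
      (𝓝 (((L1 1 - L0 0) + (L0 c - L1 c)) / 2 +
        Real.log (1 - Real.exp (-L1 c) * Real.exp (-L0 c)) -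
        Real.log (1 - Real.exp (-L0 c) ^ 2) / 2 - Real.log (1 - Real.exp (-L0 0) ^ 2) / 2 -
        Real.log (1 - Real.exp (-L1 1) ^ 2) / 2 - Real.log (1 - Real.exp (-L1 c) ^ 2) / 2)) := by
  have hM02 : 0 ≤ M02 := by
    have h := (abs_nonneg _).trans (hlip0 0 ⟨le_rfl, hc0.le⟩ c ⟨hc0.le, le_rfl⟩)
    rw [abs_of_pos (by linarith : 0 < c - 0)] at h
    nlinarith
  have hM12 : 0 ≤ M12 := by
    have h := (abs_nonneg _).trans (hlip1 c ⟨le_rfl, hc1.le⟩ 1 ⟨hc1.le, le_rfl⟩)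
    rw [abs_of_pos (by linarith : 0 < 1 - c)] at h
    nlinarith
  set m : ℕ → ℕ := fun n => ⌊(n : ℝ) * c⌋₊ with hm
  have hmle : ∀ n : ℕ, (m n : ℝ) ≤ n * c := fun n => Nat.floor_le (by positivity)
  have hmlt : ∀ n : ℕ, (n : ℝ) * c < m n + 1 := fun n => Nat.lt_floor_add_one _
  have hfr : ∀ n : ℕ, Int.fract ((n : ℝ) * c) = n * c - m n := fun n => by
    rw [Int.fract, natCast_floor_eq_intCast_floor (by positivity)]
  have hlarge : ∀ᶠ n : ℕ in atTop, 0 < n ∧ 1 ≤ m n ∧ m n + 1 ≤ n := by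
    have h1 := (tendsto_natCast_atTop_atTop (R := ℝ)).atTop_mul_const hc0
    have h2 := (tendsto_natCast_atTop_atTop (R := ℝ)).atTop_mul_const (sub_pos.2 hc1)
    filter_upwards [h1.eventually_ge_atTop 1, h2.eventually_ge_atTop 1, eventually_gt_atTop 0]
      with n h3 h4 h5
    refine ⟨h5, Nat.le_floor (by simpa using h3), ?_⟩
    have : ((m n + 1 : ℕ) : ℝ) ≤ n := by push_cast; nlinarith [hmle n]
    exact_mod_cast this
  have hs0 := segment_tendsto (τ := 0) (N := fun n => m n - 1) (y := fun n => (n : ℝ)⁻¹) (T := T)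
    hc0 hL0 hl0 hl0' hM01 hlip0 hM02
    (by
      filter_upwards with n
      exact ⟨by positivity, by simp⟩)
    (by
      filter_upwards [hlarge] with n ⟨hn, h1, h2⟩
      have hn' : (0 : ℝ) < n := by exact_mod_cast hn
      have h3 : (n : ℝ)⁻¹ + ((m n - 1 : ℕ) : ℝ) * (n : ℝ)⁻¹ = m n / n := by
        push_cast [h1]; ring
      rw [h3, div_le_iff₀ hn', le_div_iff₀ hn', sub_mul, inv_mul_cancel₀ hn'.ne']
      constructor <;> linarith [hmle n, hmlt n])
    (by
      filter_upwards [hlarge] with n ⟨hn, h1, h2⟩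
      have hn' : (0 : ℝ) < n := by exact_mod_cast hn
      refine ⟨(hT n).ge, (hT n).le.trans zero_le_one, fun j hj => ?_⟩
      have hj' : ((j + 1 : ℕ) : ℝ) ≤ m n := by exact_mod_cast (by omega : j + 1 ≤ m n)
      push_cast at hj'
      rw [hT0 n j hn ((div_le_iff₀ hn').2 (by linarith [hmle n])),
        show ((j : ℝ) + 1) / n = (n : ℝ)⁻¹ + j * (n : ℝ)⁻¹ by ring])
    zero_le_one (by simp [hT])
  obtain ⟨hu0, he0, hlim0⟩ := hs0
  have hm1 : ∀ᶠ n : ℕ in atTop, m n - 1 + 1 = m n := hlarge.mono fun n h => by omega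
  have hs1 := segment_tendsto (τ := Real.exp (-L0 c)) (N := fun n => n - m n - 1)
    (y := fun n => ((m n : ℝ) + 1) / n) (T := fun n j => T n (m n + j))
    hc1 hL1 hl1 hl1' hM11 hlip1 hM12
    (by
      filter_upwards [hlarge] with n ⟨hn, h1, h2⟩
      have hn' : (0 : ℝ) < n := by exact_mod_cast hn
      rw [div_le_iff₀ hn', le_div_iff₀ hn', add_mul, inv_mul_cancel₀ hn'.ne']
      constructor <;> linarith [hmle n, hmlt n])
    (by
      filter_upwards [hlarge] with n ⟨hn, h1, h2⟩
      have hn' : (0 : ℝ) < n := by exact_mod_cast hn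
      have h3 : ((m n : ℝ) + 1) / n + ((n - m n - 1 : ℕ) : ℝ) * (n : ℝ)⁻¹ = 1 := by
        rw [Nat.sub_sub, Nat.cast_sub h2]
        push_cast
        field_simp
        ring
      rw [h3]
      exact ⟨by linarith [inv_pos.2 hn'], le_rfl⟩)
    (by
      filter_upwards [hlarge, hu0, hm1] with n ⟨hn, h1, h2⟩ h3 h4
      have hn' : (0 : ℝ) < n := by exact_mod_cast hn
      refine ⟨(h3 (m n) h4.ge).1, (h3 (m n) h4.ge).2, fun j hj => ?_⟩
      have hj' : ((m n + j + 1 : ℕ) : ℝ) ≤ n := by exact_mod_cast (by omega : m n + j + 1 ≤ n)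
      push_cast at hj'
      have hj0 : (0 : ℝ) ≤ j := by positivity
      rw [← add_assoc, hT1 n (m n + j) hn ((lt_div_iff₀ hn').2 (by push_cast; linarith [hmlt n]))
        ((div_le_iff₀ hn').2 (by push_cast; linarith)),
        show (((m n + j : ℕ) : ℝ) + 1) / n = ((m n : ℝ) + 1) / n + j * (n : ℝ)⁻¹ by
          push_cast; ring])
    (Real.exp_le_one_iff.2 (by linarith [hl0' c ⟨hc0.le, le_rfl⟩]))
    (he0.congr' (hm1.mono fun n h => by simp only [h, add_zero]))
  obtain ⟨hu1, -, hlim1⟩ := hs1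
  refine ⟨?_, ?_⟩
  · filter_upwards [hlarge, hu0, hu1, hm1] with n ⟨hn, h1, h2⟩ h3 h4 h5 j hj
    rcases le_total j (m n) with h | h
    · exact h3 j (by omega)
    · have := h4 (j - m n) (by omega)
      rwa [Nat.add_sub_cancel' h] at this
  · have hall := (hlim0.add hlim1).sub_const (L0 0 + L1 c)
    have hlim : ((L0 0 + L0 c) / 2 + Real.log (1 - Real.exp (-L0 0) * 0) -
        Real.log (1 - Real.exp (-L0 c) ^ 2) / 2 - Real.log (1 - Real.exp (-L0 0) ^ 2) / 2 +
        ((L1 c + L1 1) / 2 + Real.log (1 - Real.exp (-L1 c) * Real.exp (-L0 c)) -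
        Real.log (1 - Real.exp (-L1 1) ^ 2) / 2 - Real.log (1 - Real.exp (-L1 c) ^ 2) / 2)) -
        (L0 0 + L1 c) = ((L1 1 - L0 0) + (L0 c - L1 c)) / 2 +
        Real.log (1 - Real.exp (-L1 c) * Real.exp (-L0 c)) -
        Real.log (1 - Real.exp (-L0 c) ^ 2) / 2 - Real.log (1 - Real.exp (-L0 0) ^ 2) / 2 -
        Real.log (1 - Real.exp (-L1 1) ^ 2) / 2 - Real.log (1 - Real.exp (-L1 c) ^ 2) / 2 := by
      rw [mul_zero, sub_zero, Real.log_one]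
      ring
    rw [hlim] at hall
    refine hall.congr' ?_
    filter_upwards [hlarge] with n ⟨hn, h1, h2⟩
    have hn' : (n : ℝ) ≠ 0 := by positivity
    have hsum : ∑ j ∈ Finset.range n, -Real.log (T n (j + 1)) =
        ∑ j ∈ Finset.range (m n - 1 + 1), -Real.log (T n (j + 1)) +
        ∑ j ∈ Finset.range (n - m n - 1 + 1), -Real.log (T n (m n + (j + 1))) := by
      rw [show m n - 1 + 1 = m n by omega, show n - m n - 1 + 1 = n - m n by omega]
      conv_lhs => rw [show n = m n + (n - m n) by omega, Finset.sum_range_add]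
      simp only [add_assoc, Nat.add_sub_cancel' (by omega : m n ≤ n)]
    have h3 : (n : ℝ) * (n : ℝ)⁻¹ = 1 := mul_inv_cancel₀ hn'
    have h4 : ((m n - 1 : ℕ) : ℝ) = m n - 1 := by push_cast [h1]; ring
    have h5 : ((n - m n - 1 : ℕ) : ℝ) = n - (m n + 1) := by
      rw [Nat.sub_sub, Nat.cast_sub h2]; push_cast; ring
    rw [hsum, hfr, h4, h5]
    field_simp
    ring

lemma exp_arcosh_div_two {g : ℝ} (hg : 2 < g) :
    Real.exp (Real.arcosh (g / 2)) = (g + Real.sqrt (g ^ 2 - 4)) / 2 := by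
  have h : Real.sqrt ((g / 2) ^ 2 - 1) = Real.sqrt (g ^ 2 - 4) / 2 := by
    rw [show (g / 2) ^ 2 - 1 = (g ^ 2 - 4) / 2 ^ 2 by ring,
      Real.sqrt_div (by nlinarith), Real.sqrt_sq (by norm_num)]
  rw [Real.exp_arcosh (by linarith), h]
  ring

lemma exp_neg_arcosh_div_two {g : ℝ} (hg : 2 < g) :
    Real.exp (-Real.arcosh (g / 2)) = (g - Real.sqrt (g ^ 2 - 4)) / 2 := by
  have h := Real.sq_sqrt (by nlinarith : 0 ≤ g ^ 2 - 4)
  have h0 := Real.sqrt_nonneg (g ^ 2 - 4)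
  rw [Real.exp_neg, exp_arcosh_div_two hg]
  refine inv_eq_of_mul_eq_one_right ?_
  linear_combination (-1 / 4) * h

lemma two_mul_cosh_arcosh_div_two {g : ℝ} (hg : 2 < g) :
    2 * Real.cosh (Real.arcosh (g / 2)) = g := by
  rw [Real.cosh_arcosh (by linarith)]
  ring

lemma sq_sub_four_mul_rpow {g h : ℝ} (hg : 2 < g) (hh : 2 < h) :
    ((g ^ 2 - 4) * (h ^ 2 - 4)) ^ ((1 : ℝ) / 4) =
      Real.exp ((Real.arcosh (g / 2) + Real.arcosh (h / 2)) / 2 +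
        Real.log (1 - Real.exp (-Real.arcosh (g / 2)) ^ 2) / 2 +
        Real.log (1 - Real.exp (-Real.arcosh (h / 2)) ^ 2) / 2) := by
  have key : ∀ u : ℝ, 2 < u → u ^ 2 - 4 =
      Real.exp (2 * (Real.arcosh (u / 2) +
        Real.log (1 - Real.exp (-Real.arcosh (u / 2)) ^ 2))) := by
    intro u hu
    have hpos := Real.arcosh_pos (by linarith : 1 < u / 2)
    have h1 : Real.exp (-Real.arcosh (u / 2)) < 1 := Real.exp_lt_one_iff.2 (by linarith)
    have h0 := Real.exp_pos (-Real.arcosh (u / 2))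
    have h2 : Real.exp (Real.arcosh (u / 2)) * Real.exp (-Real.arcosh (u / 2)) = 1 := by
      rw [← Real.exp_add]
      simp
    have h3 : Real.exp (Real.arcosh (u / 2)) + Real.exp (-Real.arcosh (u / 2)) = u := by
      rw [exp_arcosh_div_two hu, exp_neg_arcosh_div_two hu]
      ring
    rw [two_mul, Real.exp_add, Real.exp_add, Real.exp_log (by nlinarith)]
    conv_lhs => rw [← h3]
    generalize Real.exp (Real.arcosh (u / 2)) = v at *
    generalize Real.exp (-Real.arcosh (u / 2)) = w at *
    linear_combination (2 + 2 * (v * w + 1) - w ^ 2 * (v * w + 1)) * h2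
  rw [key g hg, key h hh, ← Real.exp_add, ← Real.exp_mul]
  ring_nf

lemma log_div_two_eq_arcosh {g : ℝ} (hg : 2 < g) :
    Real.log ((g + Real.sqrt (g ^ 2 - 4)) / 2) = Real.arcosh (g / 2) := by
  rw [← exp_arcosh_div_two hg, Real.log_exp]

/-- The solution of the Riccati recurrence `t (j + 1) = (f ((j + 1) / n) - t j)⁻¹`, `t 0 = 0`. -/
noncomputable def riccatiSol (f : ℝ → ℝ) (n : ℕ) : ℕ → ℝ
  | 0 => 0
  | j + 1 => (f (((j : ℝ) + 1) / n) - riccatiSol f n j)⁻¹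

lemma jump_constant {g0 g1 h0 h1 : ℝ} (hg0 : 2 < g0) (hg1 : 2 < g1) (hh0 : 2 < h0)
    (hh1 : 2 < h1) :
    Real.exp (((Real.arcosh (g1 / 2) - Real.arcosh (g0 / 2)) +
        (Real.arcosh (h0 / 2) - Real.arcosh (h1 / 2))) / 2 +
      Real.log (1 - Real.exp (-Real.arcosh (h1 / 2)) * Real.exp (-Real.arcosh (h0 / 2))) -
      Real.log (1 - Real.exp (-Real.arcosh (h0 / 2)) ^ 2) / 2 -
      Real.log (1 - Real.exp (-Real.arcosh (g0 / 2)) ^ 2) / 2 -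
      Real.log (1 - Real.exp (-Real.arcosh (g1 / 2)) ^ 2) / 2 -
      Real.log (1 - Real.exp (-Real.arcosh (h1 / 2)) ^ 2) / 2) =
    ((1/2) * (g1 + Real.sqrt (g1 ^ 2 - 4)) / ((g0 ^ 2 - 4) * (g1 ^ 2 - 4)) ^ ((1:ℝ)/4)) *
      ((h0 - h1 + Real.sqrt (h1 ^ 2 - 4) + Real.sqrt (h0 ^ 2 - 4)) /
        (2 * ((h1 ^ 2 - 4) * (h0 ^ 2 - 4)) ^ ((1:ℝ)/4))) := by
  have hn1 : (1/2) * (g1 + Real.sqrt (g1 ^ 2 - 4)) = Real.exp (Real.arcosh (g1 / 2)) := by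
    rw [exp_arcosh_div_two hg1]
    ring
  have hb0 := Real.arcosh_pos (by linarith : 1 < h0 / 2)
  have hb1 := Real.arcosh_pos (by linarith : 1 < h1 / 2)
  have hn2 : h0 - h1 + Real.sqrt (h1 ^ 2 - 4) + Real.sqrt (h0 ^ 2 - 4) =
      2 * (Real.exp (Real.arcosh (h0 / 2) +
        Real.log (1 - Real.exp (-Real.arcosh (h1 / 2)) * Real.exp (-Real.arcosh (h0 / 2))))) := by
    have hlt : Real.exp (-Real.arcosh (h1 / 2)) * Real.exp (-Real.arcosh (h0 / 2)) < 1 := by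
      rw [← Real.exp_add]
      exact Real.exp_lt_one_iff.2 (by linarith)
    have h2 : Real.exp (Real.arcosh (h0 / 2)) * Real.exp (-Real.arcosh (h0 / 2)) = 1 := by
      rw [← Real.exp_add]
      simp
    rw [Real.exp_add, Real.exp_log (by linarith)]
    have h3 : Real.exp (Real.arcosh (h0 / 2)) *
        (1 - Real.exp (-Real.arcosh (h1 / 2)) * Real.exp (-Real.arcosh (h0 / 2))) =
        Real.exp (Real.arcosh (h0 / 2)) - Real.exp (-Real.arcosh (h1 / 2)) := by
      linear_combination (-Real.exp (-Real.arcosh (h1 / 2))) * h2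
    rw [h3, exp_arcosh_div_two hh0, exp_neg_arcosh_div_two hh1]
    ring
  rw [hn1, hn2, sq_sub_four_mul_rpow hg0 hg1, sq_sub_four_mul_rpow hh1 hh0,
    mul_div_mul_left _ _ two_ne_zero, ← Real.exp_sub, ← Real.exp_sub, ← Real.exp_add (_ - _) (_ - _)]
  congr 1
  ring

lemma jump_ratio {h0 h1 : ℝ} (hh0 : 2 < h0) (hh1 : 2 < h1) :
    Real.exp (Real.arcosh (h1 / 2) - Real.arcosh (h0 / 2)) =
      (h1 + Real.sqrt (h1 ^ 2 - 4)) / (h0 + Real.sqrt (h0 ^ 2 - 4)) := by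
  rw [Real.exp_sub, exp_arcosh_div_two hh0, exp_arcosh_div_two hh1,
    div_div_div_cancel_right₀ two_ne_zero]

lemma Dn_eq_exp_sum {f : ℝ → ℝ} {n : ℕ} (hn : 0 < n) (hf : ∀ x ∈ Set.Icc (0 : ℝ) 1, 2 < f x)
    (hT : ∀ j ≤ n, 0 ≤ riccatiSol f n j ∧ riccatiSol f n j ≤ 1) :
    Dn f n = Real.exp (∑ j ∈ Finset.range n, -Real.log (riccatiSol f n (j + 1))) := by
  have hpos : ∀ j < n, 0 < f (((j : ℝ) + 1) / n) - riccatiSol f n j := by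
    intro j hj
    have hn' : (0 : ℝ) < n := by exact_mod_cast hn
    have h1 : ((j : ℝ) + 1) / n ≤ 1 := by
      rw [div_le_one hn']
      exact_mod_cast hj
    linarith [hf _ ⟨by positivity, h1⟩, (hT j hj.le).2]
  have hdet : Dn f n = ∏ j ∈ Finset.range n, (riccatiSol f n (j + 1))⁻¹ :=
    det_tridiag_eq_prod (a := fun j => f (((j : ℝ) + 1) / n)) rfl (fun _ => rfl) hpos
  rw [hdet, Real.exp_sum]
  refine Finset.prod_congr rfl fun j hj => ?_
  have : 0 < riccatiSol f n (j + 1) := inv_pos.2 (hpos j (Finset.mem_range.1 hj))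
  rw [Real.exp_neg, Real.exp_log this]

lemma Gf_eq_exp_add {c : ℝ} (hc0 : 0 < c) (hc1 : c < 1) {f g0 g1 : ℝ → ℝ}
    (hfg0 : ∀ x ∈ Set.Icc (0 : ℝ) c, f x = g0 x) (hfg1 : ∀ x ∈ Set.Ioc c 1, f x = g1 x)
    (hg0 : ContinuousOn g0 (Set.Icc 0 c)) (hg1 : ContinuousOn g1 (Set.Icc c 1))
    (h0 : ∀ x ∈ Set.Icc 0 c, 2 < g0 x) (h1 : ∀ x ∈ Set.Icc c 1, 2 < g1 x) :
    Gf f = Real.exp ((∫ s in (0 : ℝ)..c, Real.arcosh (g0 s / 2)) +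
      ∫ s in c..1, Real.arcosh (g1 s / 2)) := by
  have hLint : ∀ {p q : ℝ} {g : ℝ → ℝ}, p ≤ q → ContinuousOn g (Set.Icc p q) →
      (∀ x ∈ Set.Icc p q, 2 < g x) →
      IntervalIntegrable (fun s => Real.arcosh (g s / 2)) MeasureTheory.volume p q := by
    intro p q g hpq hg h
    refine ContinuousOn.intervalIntegrable_of_Icc hpq ?_
    exact Real.continuousOn_arcosh.comp (hg.div_const 2) fun x hx => by
      have := h x hx
      simp only [Set.mem_Ici]
      linarith
  have he0 : Set.EqOn (fun s => Real.arcosh (g0 s / 2))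
      (fun x => Real.log ((f x + Real.sqrt (f x ^ 2 - 4)) / 2)) (Set.uIoc 0 c) := by
    intro x hx
    rw [Set.uIoc_of_le hc0.le] at hx
    have hx' := Set.Ioc_subset_Icc_self hx
    simp only [hfg0 x hx', log_div_two_eq_arcosh (h0 x hx')]
  have he1 : Set.EqOn (fun s => Real.arcosh (g1 s / 2))
      (fun x => Real.log ((f x + Real.sqrt (f x ^ 2 - 4)) / 2)) (Set.uIoc c 1) := by
    intro x hx
    rw [Set.uIoc_of_le hc1.le] at hx
    simp only [hfg1 x hx, log_div_two_eq_arcosh (h1 x (Set.Ioc_subset_Icc_self hx))]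
  rw [Gf, ← intervalIntegral.integral_add_adjacent_intervals
    ((hLint hc0.le hg0 h0).congr he0) ((hLint hc1.le hg1 h1).congr he1),
    intervalIntegral.integral_congr_ae (Eventually.of_forall he0),
    intervalIntegral.integral_congr_ae (Eventually.of_forall he1)]

/-- limsup and liminf of D_n(f)/G(f)ⁿ for a symbol with a single jump at an irrational
point c, left-continuous at c.  Here f(c−) = g₀(c) = f(c) and f(c+) = g₁(c). -/
theorem limsup_liminf_irrational_jump
    (c : ℝ) (hc : Irrational c) (hc0 : 0 < c) (hc1 : c < 1)
    (f g0 g0' g0'' g1 g1' g1'' : ℝ → ℝ)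
    (hd01 : ∀ x ∈ Set.Icc (0:ℝ) c, HasDerivWithinAt g0 (g0' x) (Set.Icc (0:ℝ) c) x)
    (hd02 : ∀ x ∈ Set.Icc (0:ℝ) c, HasDerivWithinAt g0' (g0'' x) (Set.Icc (0:ℝ) c) x)
    (hbd0 : ∃ M : ℝ, ∀ x ∈ Set.Icc (0:ℝ) c, |g0'' x| ≤ M)
    (hd11 : ∀ x ∈ Set.Icc c 1, HasDerivWithinAt g1 (g1' x) (Set.Icc c 1) x)
    (hd12 : ∀ x ∈ Set.Icc c 1, HasDerivWithinAt g1' (g1'' x) (Set.Icc c 1) x)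
    (hbd1 : ∃ M : ℝ, ∀ x ∈ Set.Icc c 1, |g1'' x| ≤ M)
    (hfg0 : ∀ x ∈ Set.Icc (0:ℝ) c, f x = g0 x)
    (hfg1 : ∀ x ∈ Set.Ioc c 1, f x = g1 x)
    (hjump : g0 c ≠ g1 c)
    (δ : ℝ) (hδ : 0 < δ) (hf2 : ∀ x ∈ Set.Icc (0:ℝ) 1, 2 + δ < f x) :
    Filter.limsup (fun n : ℕ => Dn f n / (Gf f) ^ n) atTop =
      ((1/2) * (f 1 + Real.sqrt (f 1 ^ 2 - 4)) /
          ((f 0 ^ 2 - 4) * (f 1 ^ 2 - 4)) ^ ((1:ℝ)/4)) *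
      ((g0 c - g1 c + Real.sqrt ((g1 c) ^ 2 - 4) + Real.sqrt ((g0 c) ^ 2 - 4)) /
          (2 * (((g1 c) ^ 2 - 4) * ((g0 c) ^ 2 - 4)) ^ ((1:ℝ)/4))) *
      max 1 ((g1 c + Real.sqrt ((g1 c) ^ 2 - 4)) /
              (g0 c + Real.sqrt ((g0 c) ^ 2 - 4))) ∧
    Filter.liminf (fun n : ℕ => Dn f n / (Gf f) ^ n) atTop =
      ((1/2) * (f 1 + Real.sqrt (f 1 ^ 2 - 4)) /
          ((f 0 ^ 2 - 4) * (f 1 ^ 2 - 4)) ^ ((1:ℝ)/4)) *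
      ((g0 c - g1 c + Real.sqrt ((g1 c) ^ 2 - 4) + Real.sqrt ((g0 c) ^ 2 - 4)) /
          (2 * (((g1 c) ^ 2 - 4) * ((g0 c) ^ 2 - 4)) ^ ((1:ℝ)/4))) *
      min 1 ((g1 c + Real.sqrt ((g1 c) ^ 2 - 4)) /
              (g0 c + Real.sqrt ((g0 c) ^ 2 - 4))) := by
  obtain ⟨B0, hB0⟩ := hbd0
  obtain ⟨B1, hB1⟩ := hbd1
  have hg0c : ContinuousOn g0 (Set.Icc 0 c) := fun x hx => (hd01 x hx).continuousWithinAt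
  have hg1c : ContinuousOn g1 (Set.Icc c 1) := fun x hx => (hd11 x hx).continuousWithinAt
  have hf : ∀ x ∈ Set.Icc (0 : ℝ) 1, 2 < f x := fun x hx => by linarith [hf2 x hx]
  have h0 : ∀ x ∈ Set.Icc 0 c, 2 < g0 x := fun x hx => by
    rw [← hfg0 x hx]
    exact hf x ⟨hx.1, hx.2.trans hc1.le⟩
  have h1 : ∀ x ∈ Set.Icc c 1, 2 < g1 x := by
    have hcl : ∀ x ∈ Set.Icc c 1, 2 + δ ≤ g1 x := by
      intro x hx
      rw [← closure_Ioc hc1.ne] at hx hg1c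
      refine ContinuousWithinAt.closure_le hx continuousWithinAt_const
        ((hg1c x hx).mono subset_closure) fun y hy => ?_
      rw [← hfg1 y hy]
      exact (hf2 y ⟨hc0.le.trans hy.1.le, hy.2⟩).le
    exact fun x hx => by linarith [hcl x hx]
  obtain ⟨L0', l0, M01, M02, hl0, hL0, hl0', hM01, hlip0⟩ :=
    exists_arcosh_comp_deriv_bounds hc0 hd01 hd02 hB0 h0
  obtain ⟨L1', l1, M11, M12, hl1, hL1, hl1', hM11, hlip1⟩ :=
    exists_arcosh_comp_deriv_bounds hc1 hd11 hd12 hB1 h1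
  obtain ⟨hunit, hlim⟩ := jump_tendsto hc0 hc1 hL0 hl0 hl0' hM01 hlip0 hL1 hl1 hl1' hM11 hlip1
    (T := riccatiSol f) (fun _ => rfl)
    (fun n j hn hj => by
      have hx : ((j : ℝ) + 1) / n ∈ Set.Icc 0 c := ⟨by positivity, hj⟩
      rw [two_mul_cosh_arcosh_div_two (h0 _ hx), ← hfg0 _ hx]
      rfl)
    (fun n j hn hj hj' => by
      have hx : ((j : ℝ) + 1) / n ∈ Set.Ioc c 1 := ⟨hj, hj'⟩
      rw [two_mul_cosh_arcosh_div_two (h1 _ (Set.Ioc_subset_Icc_self hx)), ← hfg1 _ hx]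
      rfl)
  have hc_mem0 : c ∈ Set.Icc 0 c := ⟨hc0.le, le_rfl⟩
  have hc_mem1 : c ∈ Set.Icc c 1 := ⟨le_rfl, hc1.le⟩
  have hz : (0 : ℝ) ∈ Set.Icc 0 c := ⟨le_rfl, hc0.le⟩
  have ho : (1 : ℝ) ∈ Set.Icc c 1 := ⟨hc1.le, le_rfl⟩
  have hf0 : f 0 = g0 0 := hfg0 0 hz
  have hf1 : f 1 = g1 1 := hfg1 1 ⟨hc1, le_rfl⟩
  have hconst := jump_constant (h0 0 hz) (h1 1 ho) (h0 c hc_mem0) (h1 c hc_mem1)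
  rw [hf0, hf1, ← hconst, ← jump_ratio (h0 c hc_mem0) (h1 c hc_mem1)]
  have he := tendsto_sub_nhds_zero_iff.2 hlim
  rw [← limsup_exp_fract_mul_add hc _ _ he, ← liminf_exp_fract_mul_add hc _ _ he]
  refine ⟨limsup_congr ?_, liminf_congr ?_⟩ <;>
  · filter_upwards [hunit, eventually_gt_atTop 0] with n hn hn0
    rw [Dn_eq_exp_sum hn0 hf hn, Gf_eq_exp_add hc0 hc1 hfg0 hfg1 hg0c hg1c h0 h1,
      ← Real.exp_nat_mul, ← Real.exp_sub]
    congr 1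
    ring
end

section
/- Let c ∈ (0,1) be irrational and let f : [0,1] → ℝ have a single jump discontinuity at c, be left-continuous at c, and satisfy: there are functions g_0 (twice differentiable with bounded second derivative on [0,c]) and g_1 (twice differentiable with bounded second derivative on [c,1]) with f(x) = g_0(x) for x ∈ [0,c], f(x) = g_1(x) for x ∈ (c,1], g_0(c) ≠ g_1(c), and f > 2 + δ for some δ > 0. Set f(c−) = g_0(c), f(c+) = g_1(c), α = (1/2)(f(1)+√(f(1)²−4))/((f(0)²−4)(f(1)²−4))^{1/4}, β = (f(c−) − f(c+) + √(f(c+)² − 4) + √(f(c−)² − 4)) / (2((f(c+)² − 4)(f(c−)² − 4))^{1/4}), and γ = (f(c+) + √(f(c+)² − 4)) / (f(c−) + √(f(c−)² − 4)). Then the set of limit points of the sequence (D_n(f)/G(f)^n)_{n≥1} is exactly the closed interval with endpoints α·β and α·β·γ. -/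
open Filter Topology

/-- The determinant of the tridiagonal matrix with diagonal `a 0, …, a (n - 1)` and entries `-1`
next to the diagonal, defined by its three-term recurrence. -/
def continuant (a : ℕ → ℝ) : ℕ → ℝ
  | 0 => 1
  | 1 => a 0
  | k + 2 => a (k + 1) * continuant a (k + 1) - continuant a k

lemma continuant_congr {a b : ℕ → ℝ} {n : ℕ} (h : ∀ k < n, a k = b k) :
    continuant a n = continuant b n := by
  induction n using Nat.strong_induction_on with
  | _ n ih =>
    match n with
    | 0 => rfl
    | 1 => exact h 0 one_pos
    | k + 2 =>
      simp only [continuant]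
      rw [h (k + 1) (by omega), ih (k + 1) (by omega) fun i hi => h i (by omega),
        ih k (by omega) fun i hi => h i (by omega)]

lemma continuant_add (a : ℕ → ℝ) (m j : ℕ) :
    continuant a (m + 1 + (j + 1)) =
      continuant a (m + 1) * continuant (fun k => a (m + 1 + k)) (j + 1) -
        continuant a m * continuant (fun k => a (m + 2 + k)) j := by
  induction j using Nat.twoStepInduction with
  | zero => simp [continuant]; ring
  | one =>
    simp only [continuant]
    ring_nf
  | more j h1 h2 =>
    have e : continuant a (m + 1 + (j + 2 + 1)) =
        a (m + 1 + (j + 2)) * continuant a (m + 1 + (j + 1 + 1)) -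
          continuant a (m + 1 + (j + 1)) := rfl
    rw [e, h1, h2]
    simp only [continuant, show m + 1 + (j + 2) = m + 2 + (j + 1) by ring]
    ring

lemma continuant_succ_succ' (a : ℕ → ℝ) (j : ℕ) :
    continuant a (j + 2) =
      a 0 * continuant (fun k => a (k + 1)) (j + 1) - continuant (fun k => a (k + 2)) j := by
  have := continuant_add a 0 j
  simp only [continuant, zero_add, one_mul] at this
  rw [show j + 2 = 1 + (j + 1) by ring, this]
  simp only [add_comm]

lemma det_tridiagonal_eq_continuant (a : ℕ → ℝ) (n : ℕ) :
    (Matrix.of fun i j : Fin n =>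
      if (i : ℕ) = (j : ℕ) then a i
      else if (i : ℕ) + 1 = (j : ℕ) ∨ (j : ℕ) + 1 = (i : ℕ) then -1 else 0).det =
      continuant a n := by
  induction n using Nat.twoStepInduction generalizing a with
  | zero => simp [continuant]
  | one => simp [continuant]
  | more n h1 h2 =>
    rw [continuant_succ_succ', ← h1, ← h2, Matrix.det_succ_row_zero, Fin.sum_univ_succ,
      Fin.sum_univ_succ, Finset.sum_eq_zero]
    · rw [Matrix.det_succ_column_zero (Matrix.submatrix _ _ (Fin.succAbove (Fin.succ 0))),
        Fin.sum_univ_succ, Finset.sum_eq_zero]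
      · simp [Matrix.submatrix, Fin.succAbove, Fin.lt_def]
        exact (sub_eq_add_neg _ _).symm
      · intro x _
        simp [Matrix.submatrix, Fin.succAbove, Fin.lt_def]
    · intro x _
      simp

lemma Dn_eq_continuant (f : ℝ → ℝ) (n : ℕ) :
    Dn f n = continuant (fun k => f (((k : ℝ) + 1) / n)) n :=
  det_tridiagonal_eq_continuant (fun k => f (((k : ℝ) + 1) / n)) n

lemma continuant_pos_of_two_le {a : ℕ → ℝ} (ha : ∀ k, 2 ≤ a k) (n : ℕ) :
    0 < continuant a n ∧ continuant a n ≤ continuant a (n + 1) := by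
  induction n with
  | zero => exact ⟨by simp [continuant], by simp only [continuant]; linarith [ha 0]⟩
  | succ n ih =>
    refine ⟨ih.1.trans_le ih.2, ?_⟩
    have : continuant a (n + 1 + 1) = a (n + 1) * continuant a (n + 1) - continuant a n := rfl
    rw [this]
    nlinarith [ha (n + 1)]

set_option maxHeartbeats 1000000 in
/-- Discrete WKB estimate: an adiabatic invariant for the normalised recurrence. -/
lemma wkb_estimate {q C : ℝ} (hq0 : 0 < q) (hq1 : q < 1) (hC : 0 ≤ C) :
    ∃ K : ℝ, ∀ (h : ℝ) (ν E Q : ℕ → ℝ), 0 < h → h ≤ 1 → (∀ k, 0 < ν k ∧ ν k ≤ q) →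
      (∀ k, |ν k - ν (k + 1)| ≤ C * h) → E 0 = 1 → Q 0 = 1 →
      (∀ k, E (k + 1) = ν k ^ 2 * E k + Q k) →
      (∀ k, Q (k + 1) = Q k + ν k * (ν k - ν (k + 1)) * E k) →
      ∀ k : ℕ, k * h ≤ 1 →
        |E k ^ 2 * (1 - ν k ^ 2) - 1 / (1 - ν 0 ^ 2)| ≤ K * (h + (q ^ 2) ^ k) := by
  set σ : ℝ := 1 - q ^ 2 with hσ
  have hσ0 : 0 < σ := by rw [hσ]; nlinarith
  set M : ℝ := Real.exp (C / σ) / σ with hM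
  have hM1 : 0 < M := by positivity
  set R : ℝ := 4 * (C * M) / σ with hR
  have hR0 : 0 ≤ R := by positivity
  set A : ℝ := (2 * C * M + 2 * C ^ 2 * M ^ 2) / σ ^ 2 with hA
  have hA0 : 0 ≤ A := by positivity
  set B : ℝ := A * (1 / σ + R + 1) with hB
  have hB0 : 0 ≤ B := by positivity
  set D : ℝ := (2 * M + 1 + R) / σ with hD
  have hD0 : 0 ≤ D := by positivity
  refine ⟨B + D * (R + 1), ?_⟩
  intro h ν E Q hh hh1 hν hd hE0 hQ0 hE hQ k hk
  have hν2 : ∀ j, ν j ^ 2 ≤ q ^ 2 := fun j => by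
    have := hν j; exact pow_le_pow_left₀ this.1.le this.2 2
  have hw : ∀ j, σ ≤ 1 - ν j ^ 2 := fun j => by have := hν2 j; rw [hσ]; linarith
  have hw1 : ∀ j, 1 - ν j ^ 2 ≤ 1 := fun j => by have := sq_nonneg (ν j); linarith
  -- growth bounds
  have grow : ∀ j : ℕ, |Q j| ≤ (1 + C * h / σ) ^ j ∧ |E j| ≤ (1 + C * h / σ) ^ j / σ := by
    intro j
    induction j with
    | zero =>
      simp only [hQ0, hE0, abs_one, pow_zero, le_refl, true_and]
      rw [le_div_iff₀ hσ0, hσ]; nlinarith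
    | succ j ih =>
      set b := (1 + C * h / σ) ^ j with hb
      have hb0 : 0 < b := by positivity
      have h1 : (1 + C * h / σ) ^ (j + 1) = b + C * h * (b / σ) := by
        rw [pow_succ, ← hb]; field_simp
      have hp : 0 ≤ C * h * (b / σ) := by positivity
      rw [h1, hQ, hE]
      constructor
      · calc |Q j + ν j * (ν j - ν (j + 1)) * E j|
            ≤ |Q j| + |ν j * (ν j - ν (j + 1)) * E j| := abs_add_le _ _
          _ = |Q j| + ν j * |ν j - ν (j + 1)| * |E j| := by
            rw [abs_mul, abs_mul, abs_of_pos (hν j).1]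
          _ ≤ b + 1 * (C * h) * (b / σ) := by
            gcongr
            · exact ih.1
            · exact (hν j).2.trans hq1.le
            · exact hd j
            · exact ih.2
          _ = _ := by ring
      · calc |ν j ^ 2 * E j + Q j| ≤ |ν j ^ 2 * E j| + |Q j| := abs_add_le _ _
          _ = ν j ^ 2 * |E j| + |Q j| := by rw [abs_mul, abs_of_nonneg (sq_nonneg (ν j))]
          _ ≤ q ^ 2 * (b / σ) + b := by
            gcongr
            · exact (hν j).1.le
            · exact (hν j).2
            · exact ih.2
            · exact ih.1
          _ = b / σ := by rw [hσ] at *; field_simp; ring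
          _ ≤ _ := by gcongr; linarith
  have hpow : ∀ j ≤ k, (1 + C * h / σ) ^ j ≤ Real.exp (C / σ) := by
    intro j hj
    calc (1 + C * h / σ) ^ j ≤ Real.exp (C * h / σ) ^ j := by
          gcongr; linarith [Real.add_one_le_exp (C * h / σ)]
      _ = Real.exp (j * h * (C / σ)) := by rw [← Real.exp_nat_mul]; ring_nf
      _ ≤ Real.exp (1 * (C / σ)) := by
          gcongr
          refine le_trans ?_ hk
          gcongr
      _ = _ := by rw [one_mul]
  have bE : ∀ j ≤ k, |E j| ≤ M := fun j hj =>
    (grow j).2.trans (by rw [hM]; gcongr; exact hpow j hj)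
  have bQ : ∀ j ≤ k, |Q j| ≤ M := fun j hj =>
    (grow j).1.trans ((hpow j hj).trans (by
      rw [hM, le_div_iff₀ hσ0]
      have : σ ≤ 1 := (hw j).trans (hw1 j)
      nlinarith [Real.exp_pos (C / σ)]))
  -- the residual
  set p : ℕ → ℝ := fun j => (1 - ν j ^ 2) * E j - Q j with hp
  have bp : ∀ j ≤ k, |p j| ≤ (q ^ 2) ^ j + R * h := by
    intro j
    induction j with
    | zero =>
      intro _
      have : |p 0| = ν 0 ^ 2 := by
        simp only [hp, hE0, hQ0]
        rw [show (1 - ν 0 ^ 2) * 1 - 1 = -(ν 0 ^ 2) by ring, abs_neg,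
          abs_of_nonneg (sq_nonneg _)]
      rw [this, pow_zero]
      have := hw 0
      nlinarith [mul_nonneg hR0 hh.le]
    | succ j ih =>
      intro hj
      have e : p (j + 1) = ν j ^ 2 * p j + (ν j - ν (j + 1)) *
          ((ν j + ν (j + 1)) * E (j + 1) - ν j * E j) := by
        simp only [hp, hQ j, hE j]; ring
      have h2 : |(ν j + ν (j + 1)) * E (j + 1) - ν j * E j| ≤ 4 * M := by
        calc |(ν j + ν (j + 1)) * E (j + 1) - ν j * E j|
            ≤ |(ν j + ν (j + 1)) * E (j + 1)| + |ν j * E j| := abs_sub _ _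
          _ = (ν j + ν (j + 1)) * |E (j + 1)| + ν j * |E j| := by
            rw [abs_mul, abs_mul, abs_of_pos (hν j).1,
              abs_of_pos (add_pos (hν j).1 (hν (j + 1)).1)]
          _ ≤ (1 + 1) * M + 1 * M := by
            gcongr
            · exact (hν j).2.trans hq1.le
            · exact (hν _).2.trans hq1.le
            · exact bE _ hj
            · exact (hν j).2.trans hq1.le
            · exact bE _ (by omega)
          _ ≤ _ := by linarith
      rw [e]
      calc |ν j ^ 2 * p j + (ν j - ν (j + 1)) * ((ν j + ν (j + 1)) * E (j + 1) - ν j * E j)|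
          ≤ |ν j ^ 2 * p j| + |(ν j - ν (j + 1)) * ((ν j + ν (j + 1)) * E (j + 1) - ν j * E j)| :=
            abs_add_le _ _
        _ = ν j ^ 2 * |p j| +
            |ν j - ν (j + 1)| * |(ν j + ν (j + 1)) * E (j + 1) - ν j * E j| := by
            rw [abs_mul, abs_mul, abs_of_nonneg (sq_nonneg (ν j))]
        _ ≤ q ^ 2 * ((q ^ 2) ^ j + R * h) + (C * h) * (4 * M) := by
            gcongr
            · exact (hν j).1.le
            · exact (hν j).2
            · exact ih (by omega)
            · exact hd j
        _ = _ := by rw [hR, hσ] at *; field_simp; ring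
  -- the adiabatic invariant
  set Y : ℕ → ℝ := fun j => Q j ^ 2 / (1 - ν j ^ 2) with hY
  have hwp : ∀ j, 0 < 1 - ν j ^ 2 := fun j => hσ0.trans_le (hw j)
  have stepY : ∀ j < k, |Y (j + 1) - Y j| ≤ A * h * ((q ^ 2) ^ j + (R + 1) * h) := by
    intro j hj
    have hw0 := hwp j
    have hw0' := hwp (j + 1)
    set d := ν j - ν (j + 1) with hdd
    have e : Y (j + 1) - Y j =
        (2 * ν j * d * Q j * p j + d ^ 2 * (ν j ^ 2 * E j ^ 2 * (1 - ν j ^ 2) + Q j ^ 2)) /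
          ((1 - ν j ^ 2) * (1 - ν (j + 1) ^ 2)) := by
      simp only [hY, hp, hQ j]
      rw [div_sub_div _ _ hw0'.ne' hw0.ne']
      rw [hdd]
      field_simp
      ring
    have n1 : |2 * ν j * d * Q j * p j| ≤ 2 * C * M * h * ((q ^ 2) ^ j + R * h) := by
      calc |2 * ν j * d * Q j * p j| = 2 * ν j * |d| * |Q j| * |p j| := by
            simp only [abs_mul, abs_two, abs_of_pos (hν j).1]
        _ ≤ 2 * 1 * (C * h) * M * ((q ^ 2) ^ j + R * h) := by
            gcongr
            · exact (hν j).2.trans hq1.le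
            · exact hd j
            · exact bQ j hj.le
            · exact bp j hj.le
        _ = _ := by ring
    have n2 : |d ^ 2 * (ν j ^ 2 * E j ^ 2 * (1 - ν j ^ 2) + Q j ^ 2)| ≤
        2 * C ^ 2 * M ^ 2 * h ^ 2 := by
      have hd2 : d ^ 2 ≤ (C * h) ^ 2 := by
        rw [← sq_abs]; exact pow_le_pow_left₀ (abs_nonneg _) (hd j) 2
      have hE2 : E j ^ 2 ≤ M ^ 2 := by
        rw [← sq_abs]; exact pow_le_pow_left₀ (abs_nonneg _) (bE j hj.le) 2
      have hQ2 : Q j ^ 2 ≤ M ^ 2 := by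
        rw [← sq_abs]; exact pow_le_pow_left₀ (abs_nonneg _) (bQ j hj.le) 2
      rw [abs_of_nonneg (by positivity)]
      calc d ^ 2 * (ν j ^ 2 * E j ^ 2 * (1 - ν j ^ 2) + Q j ^ 2)
          ≤ (C * h) ^ 2 * (1 * M ^ 2 * 1 + M ^ 2) := by
            gcongr
            · linarith
            · exact hw1 j
        _ = _ := by ring
    have hden : σ ^ 2 ≤ (1 - ν j ^ 2) * (1 - ν (j + 1) ^ 2) := by
      rw [sq]; exact mul_le_mul (hw j) (hw _) hσ0.le hw0.le
    rw [e, abs_div, abs_of_pos (mul_pos hw0 hw0')]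
    calc _ ≤ (2 * C * M * h * ((q ^ 2) ^ j + R * h) + 2 * C ^ 2 * M ^ 2 * h ^ 2) / σ ^ 2 := by
          gcongr
          exact (abs_add_le _ _).trans (add_le_add n1 n2)
      _ ≤ ((2 * C * M + 2 * C ^ 2 * M ^ 2) * h * ((q ^ 2) ^ j + (R + 1) * h)) / σ ^ 2 := by
          gcongr
          have t1 : 0 ≤ 2 * C * M * h * h := by positivity
          have t2 : 0 ≤ 2 * C ^ 2 * M ^ 2 * h * ((q ^ 2) ^ j + R * h) := by positivity
          nlinarith
      _ = _ := by rw [hA]; ring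
  have sumY : |Y k - Y 0| ≤ B * h := by
    calc |Y k - Y 0| = |∑ j ∈ Finset.range k, (Y (j + 1) - Y j)| := by
          rw [Finset.sum_range_sub]
      _ ≤ ∑ j ∈ Finset.range k, |Y (j + 1) - Y j| := Finset.abs_sum_le_sum_abs _ _
      _ ≤ ∑ j ∈ Finset.range k, A * h * ((q ^ 2) ^ j + (R + 1) * h) :=
          Finset.sum_le_sum fun j hj => stepY j (Finset.mem_range.1 hj)
      _ = A * h * (∑ j ∈ Finset.range k, (q ^ 2) ^ j + (R + 1) * (k * h)) := by
          rw [← Finset.mul_sum, Finset.sum_add_distrib]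
          simp only [Finset.sum_const, Finset.card_range, nsmul_eq_mul]
          ring
      _ ≤ A * h * (1 / σ + (R + 1) * 1) := by
          gcongr
          rw [geom_sum_eq (by linarith), hσ, ← neg_div_neg_eq]
          rw [hσ] at hσ0
          have : 0 ≤ (q ^ 2) ^ k := by positivity
          rw [neg_sub, neg_sub]
          gcongr
          linarith
      _ = B * h := by rw [hB]; ring
  have hY0 : Y 0 = 1 / (1 - ν 0 ^ 2) := by simp [hY, hQ0]
  have e : E k ^ 2 * (1 - ν k ^ 2) = Y k + p k * (2 * Q k + p k) / (1 - ν k ^ 2) := by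
    simp only [hY, hp]
    have := (hwp k).ne'
    field_simp
    ring
  have bpk := bp k le_rfl
  have hqpow : (q ^ 2) ^ k ≤ 1 := pow_le_one₀ (by positivity) (by nlinarith)
  have bp1 : |p k| ≤ 1 + R := bpk.trans (by nlinarith)
  have b2 : |p k * (2 * Q k + p k) / (1 - ν k ^ 2)| ≤ D * |p k| := by
    rw [abs_div, abs_mul, abs_of_pos (hwp k)]
    calc |p k| * |2 * Q k + p k| / (1 - ν k ^ 2) ≤ |p k| * (2 * M + (1 + R)) / σ := by
          gcongr
          · refine (abs_add_le _ _).trans (add_le_add ?_ bp1)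
            rw [abs_mul, abs_two]
            gcongr
            exact bQ k le_rfl
          · exact hw k
      _ = D * |p k| := by rw [hD]; ring
  rw [e, ← hY0]
  calc |Y k + p k * (2 * Q k + p k) / (1 - ν k ^ 2) - Y 0|
      = |(Y k - Y 0) + p k * (2 * Q k + p k) / (1 - ν k ^ 2)| := by congr 1; ring
    _ ≤ B * h + D * ((q ^ 2) ^ k + R * h) := by
        refine (abs_add_le _ _).trans (add_le_add sumY (b2.trans ?_))
        gcongr
    _ ≤ _ := by
        have t1 : 0 ≤ B * (q ^ 2) ^ k := by positivity
        have t2 : 0 ≤ D * R * (q ^ 2) ^ k := by positivity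
        have t3 : 0 ≤ D * h := by positivity
        nlinarith

lemma wkb_continuant {η C : ℝ} (hη : 0 < η) (hC : 0 ≤ C) :
    ∃ K : ℝ, ∀ (h : ℝ) (φ : ℕ → ℝ), 0 < h → h ≤ 1 → (∀ k, η ≤ φ k) →
      (∀ k, |φ k - φ (k + 1)| ≤ C * h) → ∀ k : ℕ, k * h ≤ 1 →
        |(continuant (fun j => 2 * Real.cosh (φ j)) k *
            Real.exp (-∑ j ∈ Finset.range k, φ j)) ^ 2 * (1 - Real.exp (-φ k) ^ 2) -
          1 / (1 - Real.exp (-φ 0) ^ 2)| ≤ K * (h + (Real.exp (-η) ^ 2) ^ k) := by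
  obtain ⟨K, hK⟩ := wkb_estimate (Real.exp_pos (-η)) (by simpa using hη) hC
  refine ⟨K, fun h φ hh hh1 hφ hd => ?_⟩
  set a : ℕ → ℝ := fun j => 2 * Real.cosh (φ j) with ha
  set E : ℕ → ℝ := fun k => continuant a k * Real.exp (-∑ j ∈ Finset.range k, φ j) with hE
  have key : ∀ k, E (k + 2) = (1 + Real.exp (-φ (k + 1)) ^ 2) * E (k + 1) -
      Real.exp (-φ (k + 1)) * Real.exp (-φ k) * E k := by
    intro k
    simp only [hE, Finset.sum_range_succ, neg_add, Real.exp_add]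
    have e : continuant a (k + 2) = a (k + 1) * continuant a (k + 1) - continuant a k := rfl
    have e2 : a (k + 1) = Real.exp (φ (k + 1)) + Real.exp (-φ (k + 1)) := by
      rw [ha]; simp only [Real.cosh_eq]; ring
    have e3 : Real.exp (φ (k + 1)) * Real.exp (-φ (k + 1)) = 1 := by
      rw [← Real.exp_add]; simp
    rw [e, e2]
    linear_combination (continuant a (k + 1) * Real.exp (-∑ j ∈ Finset.range k, φ j) *
      Real.exp (-φ k)) * e3
  refine hK h (fun k => Real.exp (-φ k)) E (fun k => E (k + 1) - Real.exp (-φ k) ^ 2 * E k)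
    hh hh1 (fun k => ⟨Real.exp_pos _, Real.exp_le_exp.2 (by linarith [hφ k])⟩)
    (fun k => (abs_exp_neg_sub_exp_neg_le (by linarith [hφ k]) (by linarith [hφ (k + 1)])).trans
      (hd k)) (by simp [hE, continuant]) ?_ (fun k => by ring) ?_
  · have e2 : a 0 = Real.exp (φ 0) + Real.exp (-φ 0) := by
      rw [ha]; simp only [Real.cosh_eq]; ring
    have e3 : Real.exp (φ 0) * Real.exp (-φ 0) = 1 := by
      rw [← Real.exp_add]; simp
    simp only [hE, continuant, Finset.range_one, Finset.sum_singleton, Finset.range_zero,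
      Finset.sum_empty, neg_zero, Real.exp_zero, zero_add, e2]
    linear_combination e3
  · intro k
    simp only [key]
    ring

lemma trapezoid_cell {F : ℝ → ℝ} (hF : Continuous F) {x h K s : ℝ} (hh : 0 ≤ h)
    (hT : ∀ y ∈ Set.Icc x (x + h), |F y - F x - s * (y - x)| ≤ K * (y - x) ^ 2) (hK : 0 ≤ K) :
    |h * ((F x + F (x + h)) / 2) - ∫ y in x..(x + h), F y| ≤ 2 * K * h ^ 3 := by
  have h1 : |∫ y in x..(x + h), (F y - F x - s * (y - x))| ≤ K * h ^ 2 * |x + h - x| := by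
    rw [← Real.norm_eq_abs]
    refine intervalIntegral.norm_integral_le_of_norm_le_const fun y hy => ?_
    rw [Set.uIoc_of_le (by linarith)] at hy
    refine (hT y ⟨hy.1.le, hy.2⟩).trans ?_
    have : 0 ≤ y - x := by linarith [hy.1]
    gcongr
    linarith [hy.2]
  have h2 : ∫ y in x..(x + h), (F y - F x - s * (y - x)) =
      (∫ y in x..(x + h), F y) - h * F x - s * (h ^ 2 / 2) := by
    rw [intervalIntegral.integral_sub, intervalIntegral.integral_sub,
      intervalIntegral.integral_const_mul, intervalIntegral.integral_sub]
    · simp only [intervalIntegral.integral_const, integral_id, smul_eq_mul]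
      ring
    all_goals exact Continuous.intervalIntegrable (by fun_prop) _ _
  have h3 := hT (x + h) ⟨by linarith, le_rfl⟩
  rw [add_sub_cancel_left] at h1 h3
  rw [h2, abs_of_nonneg hh] at h1
  have h4 : h * ((F x + F (x + h)) / 2) - ∫ y in x..(x + h), F y =
      h / 2 * (F (x + h) - F x - s * h) -
        ((∫ y in x..(x + h), F y) - h * F x - s * (h ^ 2 / 2)) := by ring
  rw [h4]
  refine (abs_sub _ _).trans ?_
  rw [abs_mul, abs_of_nonneg (by positivity : 0 ≤ h / 2)]
  have h5 : h / 2 * |F (x + h) - F x - s * h| ≤ h / 2 * (K * h ^ 2) := by gcongr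
  have : 0 ≤ K * h ^ 3 := by positivity
  nlinarith

lemma trapezoid_sum {F s : ℝ → ℝ} (hF : Continuous F) {a b K x h : ℝ} (hK : 0 ≤ K)
    (hT : ∀ x ∈ Set.Icc a b, ∀ y ∈ Set.Icc a b, |F y - F x - s x * (y - x)| ≤ K * (y - x) ^ 2)
    (hh : 0 ≤ h) (hx : a ≤ x) (N : ℕ) (hN : x + N * h ≤ b) :
    |h * (∑ k ∈ Finset.range (N + 1), F (x + k * h) - (F x + F (x + N * h)) / 2) -
      ∫ y in x..(x + N * h), F y| ≤ N * (2 * K * h ^ 3) := by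
  induction N with
  | zero => simp
  | succ N ih =>
    push_cast at hN ⊢
    have hN' : x + N * h + h ≤ b := by linarith
    have hNh : 0 ≤ N * h := by positivity
    have ih' := ih (by linarith)
    have cell := trapezoid_cell hF (x := x + N * h) (s := s (x + N * h)) hh
      (fun y hy => hT _ ⟨by linarith, by linarith⟩ y
        ⟨by linarith [hy.1], by linarith [hy.2]⟩) hK
    have e1 : x + (N + 1) * h = x + N * h + h := by ring
    rw [e1, Finset.sum_range_succ, ← intervalIntegral.integral_add_adjacent_intervals
      (hF.intervalIntegrable x (x + N * h)) (hF.intervalIntegrable _ _)]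
    push_cast
    rw [e1]
    set S := ∑ k ∈ Finset.range (N + 1), F (x + k * h)
    calc _ = |(h * (S - (F x + F (x + N * h)) / 2) - ∫ y in x..(x + N * h), F y) +
          (h * ((F (x + N * h) + F (x + N * h + h)) / 2) -
            ∫ y in (x + N * h)..(x + N * h + h), F y)| := by congr 1; ring
      _ ≤ _ := by
        refine (abs_add_le _ _).trans ?_
        linarith

lemma abs_integral_sub_mul_le_s10 {F : ℝ → ℝ} (hF : Continuous F) {L : ℝ}
    (hL : ∀ x y, |F x - F y| ≤ L * |x - y|) (hL0 : 0 ≤ L) (x y z : ℝ)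
    (hz : z ∈ Set.uIcc x y) :
    |(∫ t in x..y, F t) - (y - x) * F z| ≤ L * |y - x| ^ 2 := by
  have h2 : (∫ t in x..y, F t) - (y - x) * F z = ∫ t in x..y, (F t - F z) := by
    rw [intervalIntegral.integral_sub (hF.intervalIntegrable _ _) (by simp)]
    simp
  rw [h2, ← Real.norm_eq_abs, sq, ← mul_assoc]
  refine intervalIntegral.norm_integral_le_of_norm_le_const fun t ht => ?_
  refine (hL t z).trans ?_
  exact mul_le_mul_of_nonneg_left
    (Set.abs_sub_le_of_uIcc_subset_uIcc (Set.uIcc_subset_uIcc hz (Set.uIoc_subset_uIcc ht))) hL0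

lemma tendsto_of_abs_sub_le {F : ℝ → ℝ} {L : ℝ} (hL : ∀ x y, |F x - F y| ≤ L * |x - y|)
    {x : ℕ → ℝ} {a : ℝ} (hx : Tendsto x atTop (𝓝 a)) :
    Tendsto (fun n => F (x n)) atTop (𝓝 (F a)) := by
  rw [tendsto_iff_dist_tendsto_zero] at hx ⊢
  refine squeeze_zero (fun _ => dist_nonneg) (fun n => hL _ _) ?_
  simpa [Real.dist_eq] using hx.const_mul L

lemma continuous_of_abs_sub_le {F : ℝ → ℝ} {L : ℝ} (hL : ∀ x y, |F x - F y| ≤ L * |x - y|) :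
    Continuous F := by
  rw [continuous_iff_seqContinuous]
  exact fun x a hx => tendsto_of_abs_sub_le hL hx

section Piece

variable {F s : ℝ → ℝ} {L η K a b : ℝ} {u v : ℕ → ℝ} {N : ℕ → ℕ}

lemma tendsto_div_of_bounded (hu : ∀ n, 0 ≤ u n ∧ u n ≤ 2) :
    Tendsto (fun n : ℕ => u n / n) atTop (𝓝 0) := by
  refine squeeze_zero (g := fun n : ℕ => 2 / (n : ℝ)) (fun n => div_nonneg (hu n).1 (by positivity))
    (fun n => by have := (hu n).2; gcongr) ?_
  exact tendsto_const_div_atTop_nhds_zero_nat 2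

lemma tendsto_riemann_sum (hL0 : 0 ≤ L) (hL : ∀ x y, |F x - F y| ≤ L * |x - y|) (hK : 0 ≤ K)
    (hT : ∀ x ∈ Set.Icc a b, ∀ y ∈ Set.Icc a b, |F y - F x - s x * (y - x)| ≤ K * (y - x) ^ 2)
    (hb1 : b - a < 1)
    (hu : ∀ n, 0 ≤ u n ∧ u n ≤ 2) (hv : ∀ n, 0 ≤ v n ∧ v n ≤ 2)
    (hN : ∀ᶠ n : ℕ in atTop, N n + u n + v n = n * (b - a)) :
    Tendsto (fun n : ℕ => ∑ k ∈ Finset.range (N n + 1), F (a + (u n + k) / n) +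
      u n * F a + v n * F b - n * ∫ x in a..b, F x) atTop (𝓝 ((F a + F b) / 2)) := by
  have hF := continuous_of_abs_sub_le hL
  have hun := tendsto_div_of_bounded hu
  have hvn := tendsto_div_of_bounded hv
  have hx : Tendsto (fun n : ℕ => F (a + u n / n)) atTop (𝓝 (F a)) :=
    tendsto_of_abs_sub_le hL (by simpa using hun.const_add a)
  have hy : Tendsto (fun n : ℕ => F (b - v n / n)) atTop (𝓝 (F b)) :=
    tendsto_of_abs_sub_le hL (by simpa using hvn.const_sub b)
  refine tendsto_of_tendsto_of_dist ((hx.add hy).div_const 2) ?_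
  refine squeeze_zero' (g := fun n : ℕ => (2 * K + 8 * L) / (n : ℝ))
    (Eventually.of_forall fun _ => dist_nonneg) ?_ (tendsto_const_div_atTop_nhds_zero_nat _)
  filter_upwards [hN, eventually_gt_atTop 0] with n hn hn0
  have hn0' : (0 : ℝ) < n := Nat.cast_pos.2 hn0
  set x := a + u n / n with hxd
  set y := b - v n / n with hyd
  have hxy : x + N n * (1 / n) = y := by
    rw [hxd, hyd]; field_simp; linarith
  have hax : a ≤ x := by
    have : 0 ≤ u n / n := div_nonneg (hu n).1 hn0'.le
    linarith
  have hyb : y ≤ b := by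
    have : 0 ≤ v n / n := div_nonneg (hv n).1 hn0'.le
    linarith
  have hNn : (N n : ℝ) ≤ n := by
    have := (hu n).1
    have := (hv n).1
    nlinarith
  have h1 := trapezoid_sum hF hK hT (h := 1 / n) (by positivity) hax (N n) (by rw [hxy]; exact hyb)
  rw [hxy] at h1
  have h2 := abs_integral_sub_mul_le_s10 hF hL hL0 a x a Set.left_mem_uIcc
  have h3 := abs_integral_sub_mul_le_s10 hF hL hL0 y b b Set.right_mem_uIcc
  have hsum : ∑ k ∈ Finset.range (N n + 1), F (a + (u n + k) / n) =
      ∑ k ∈ Finset.range (N n + 1), F (x + k * (1 / n)) := by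
    refine Finset.sum_congr rfl fun k _ => ?_
    rw [hxd]; congr 1; ring
  have hsplitint : ∫ t in a..b, F t = (∫ t in a..x, F t) + (∫ t in x..y, F t) + ∫ t in y..b, F t := by
    rw [intervalIntegral.integral_add_adjacent_intervals (hF.intervalIntegrable _ _)
      (hF.intervalIntegrable _ _), intervalIntegral.integral_add_adjacent_intervals
      (hF.intervalIntegrable _ _) (hF.intervalIntegrable _ _)]
  rw [Real.dist_eq, hsum, hsplitint]
  set S := ∑ k ∈ Finset.range (N n + 1), F (x + k * (1 / n))
  have hxa : x - a = u n / n := by rw [hxd]; ring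
  have hby : b - y = v n / n := by rw [hyd]; ring
  rw [hxa] at h2
  rw [hby] at h3
  have e : (F x + F y) / 2 - (S + u n * F a + v n * F b -
      n * ((∫ t in a..x, F t) + (∫ t in x..y, F t) + ∫ t in y..b, F t)) =
      n * (-(1 / n * (S - (F x + F y) / 2) - ∫ t in x..y, F t) +
        ((∫ t in a..x, F t) - u n / n * F a) + ((∫ t in y..b, F t) - v n / n * F b)) := by
    field_simp
    ring
  rw [e, abs_mul, abs_of_pos hn0', le_div_iff₀ hn0']
  have h4 : (N n : ℝ) * (2 * K * (1 / n) ^ 3) ≤ n * (2 * K * (1 / n) ^ 3) := by gcongr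
  have hsq : ∀ w : ℝ, 0 ≤ w ∧ w ≤ 2 → L * |w / n| ^ 2 ≤ L * (2 / n) ^ 2 := by
    intro w hw
    rw [abs_of_nonneg (div_nonneg hw.1 hn0'.le)]
    have := hw.2
    have : 0 ≤ w / n := div_nonneg hw.1 hn0'.le
    gcongr
  have h5 := hsq _ (hu n)
  have h6 := hsq _ (hv n)
  rw [← abs_neg] at h1
  have h7 := (abs_add_three _ _ _).trans (add_le_add (add_le_add (h1.trans h4) (h2.trans h5))
    (h3.trans h6))
  calc _ ≤ n * (n * (2 * K * (1 / n) ^ 3) + L * (2 / n) ^ 2 + L * (2 / n) ^ 2) * n := by gcongr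
    _ = _ := by field_simp; ring

lemma tendsto_continuant_piece (hL0 : 0 ≤ L) (hL : ∀ x y, |F x - F y| ≤ L * |x - y|)
    (hη : 0 < η) (hFη : ∀ x, η ≤ F x) (hK : 0 ≤ K)
    (hT : ∀ x ∈ Set.Icc a b, ∀ y ∈ Set.Icc a b, |F y - F x - s x * (y - x)| ≤ K * (y - x) ^ 2)
    (hab : a < b) (hb1 : b - a < 1)
    (hu : ∀ n, 0 ≤ u n ∧ u n ≤ 2) (hv : ∀ n, 0 ≤ v n ∧ v n ≤ 2)
    (hN : ∀ᶠ n : ℕ in atTop, N n + u n + v n = n * (b - a)) :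
    Tendsto (fun n : ℕ => continuant (fun k => 2 * Real.cosh (F (a + (u n + k) / n))) (N n + 1) *
      Real.exp (u n * F a + v n * F b - n * ∫ x in a..b, F x)) atTop
      (𝓝 (√(1 / ((1 - Real.exp (-F a) ^ 2) * (1 - Real.exp (-F b) ^ 2))) *
        Real.exp ((F a + F b) / 2))) := by
  have hun := tendsto_div_of_bounded hu
  have hvn := tendsto_div_of_bounded hv
  have hw : ∀ x, 0 < 1 - Real.exp (-F x) ^ 2 := by
    intro x
    have h1 : Real.exp (-F x) < 1 := by
      rw [Real.exp_lt_one_iff]; linarith [hFη x]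
    have := Real.exp_pos (-F x)
    nlinarith
  have hNtop : Tendsto (fun n => N n + 1) atTop atTop := by
    rw [← tendsto_natCast_atTop_iff (R := ℝ)]
    refine tendsto_atTop_mono' (f₁ := fun n : ℕ => (n : ℝ) * (b - a) - 4) _ ?_ ?_
    · filter_upwards [hN] with n hn
      push_cast
      linarith [(hu n).2, (hv n).2]
    · exact tendsto_atTop_add_const_right _ _
        (tendsto_natCast_atTop_atTop.atTop_mul_const (sub_pos.2 hab))
  obtain ⟨K', hK'⟩ := wkb_continuant hη hL0
  set φ : ℕ → ℕ → ℝ := fun n k => F (a + (u n + k) / n) with hφ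
  set E : ℕ → ℝ := fun n => continuant (fun k => 2 * Real.cosh (φ n k)) (N n + 1) *
      Real.exp (-∑ j ∈ Finset.range (N n + 1), φ n j) with hE
  have hq : Tendsto (fun n : ℕ => K' * (1 / (n : ℝ) + (Real.exp (-η) ^ 2) ^ (N n + 1))) atTop
      (𝓝 0) := by
    have h1 : Tendsto (fun n => (Real.exp (-η) ^ 2) ^ (N n + 1)) atTop (𝓝 0) := by
      refine (tendsto_pow_atTop_nhds_zero_of_lt_one (by positivity) ?_).comp hNtop
      rw [← Real.exp_nat_mul, Real.exp_lt_one_iff]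
      push_cast
      linarith
    simpa using (tendsto_one_div_atTop_nhds_zero_nat.add h1).const_mul K'
  have hφ0 : Tendsto (fun n => φ n 0) atTop (𝓝 (F a)) :=
    tendsto_of_abs_sub_le hL (by simpa using hun.const_add a)
  have hφN : Tendsto (fun n => φ n (N n + 1)) atTop (𝓝 (F b)) := by
    refine tendsto_of_abs_sub_le hL ?_
    have h1 : Tendsto (fun n : ℕ => b - v n / n + 1 / (n : ℝ)) atTop (𝓝 b) := by
      simpa using (hvn.const_sub b).add tendsto_one_div_atTop_nhds_zero_nat
    refine h1.congr' ?_
    filter_upwards [hN, eventually_gt_atTop 0] with n hn hn0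
    have hn0' : (0 : ℝ) < n := Nat.cast_pos.2 hn0
    push_cast
    field_simp
    linarith
  have hw0 : Tendsto (fun n => 1 - Real.exp (-φ n 0) ^ 2) atTop
      (𝓝 (1 - Real.exp (-F a) ^ 2)) :=
    ((hφ0.neg.rexp).pow 2).const_sub 1
  have hwN : Tendsto (fun n => 1 - Real.exp (-φ n (N n + 1)) ^ 2) atTop
      (𝓝 (1 - Real.exp (-F b) ^ 2)) :=
    ((hφN.neg.rexp).pow 2).const_sub 1
  have hdiff : Tendsto (fun n => E n ^ 2 * (1 - Real.exp (-φ n (N n + 1)) ^ 2) -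
      1 / (1 - Real.exp (-φ n 0) ^ 2)) atTop (𝓝 0) := by
    refine squeeze_zero_norm' ?_ hq
    have hlarge : ∀ᶠ n : ℕ in atTop, 1 / (n : ℝ) < 1 - (b - a) :=
      tendsto_one_div_atTop_nhds_zero_nat.eventually_lt_const (by linarith)
    filter_upwards [hN, eventually_gt_atTop 0, hlarge] with n hn hn0 hl
    have hn0' : (0 : ℝ) < n := Nat.cast_pos.2 hn0
    have hn1 : (1 : ℝ) ≤ n := Nat.one_le_cast.2 hn0
    refine hK' (1 / n) (φ n) (by positivity) (by rw [div_le_one hn0']; exact hn1)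
      (fun k => hFη _) (fun k => ?_) (N n + 1) ?_
    · refine (hL _ _).trans_eq ?_
      congr 1
      rw [show a + (u n + k) / n - (a + (u n + (k + 1 : ℕ)) / n) = -(1 / (n : ℝ)) by
        push_cast; ring, abs_neg, abs_of_nonneg (by positivity)]
    · rw [mul_one_div, div_le_one hn0']
      rw [div_lt_iff₀ hn0'] at hl
      push_cast
      nlinarith [(hu n).1, (hv n).1]
  have hE2 : Tendsto (fun n => E n ^ 2) atTop
      (𝓝 (1 / ((1 - Real.exp (-F a) ^ 2) * (1 - Real.exp (-F b) ^ 2)))) := by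
    have h1 := (hdiff.add (hw0.inv₀ (hw a).ne')).div hwN (hw b).ne'
    rw [zero_add, ← one_div, div_div] at h1
    refine h1.congr fun n => ?_
    have : 1 - Real.exp (-φ n (N n + 1)) ^ 2 ≠ 0 := (hw _).ne'
    simp only [Pi.div_apply]
    field_simp
    ring
  have hElim : Tendsto E atTop
      (𝓝 √(1 / ((1 - Real.exp (-F a) ^ 2) * (1 - Real.exp (-F b) ^ 2)))) := by
    refine hE2.sqrt.congr fun n => Real.sqrt_sq ?_
    refine (mul_pos (continuant_pos_of_two_le (fun k => ?_) _).1 (Real.exp_pos _)).le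
    linarith [Real.one_le_cosh (φ n k)]
  refine (hElim.mul (tendsto_riemann_sum hL0 hL hK hT hb1 hu hv hN).rexp).congr fun n => ?_
  simp only [hE]
  rw [mul_assoc, ← Real.exp_add]
  congr 2
  simp only [hφ]
  ring

end Piece

section Arcosh

variable {a b : ℝ} {g g' g'' : ℝ → ℝ}

/-- For `g > 2` twice differentiable with bounded second derivative, `arcosh (g / 2)` extends to a
Lipschitz function bounded below, which satisfies a quadratic Taylor estimate. -/
lemma exists_arcosh_extension (hab : a < b)
    (hg : ∀ x ∈ Set.Icc a b, HasDerivWithinAt g (g' x) (Set.Icc a b) x)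
    (hg' : ∀ x ∈ Set.Icc a b, HasDerivWithinAt g' (g'' x) (Set.Icc a b) x)
    (hM : ∃ M : ℝ, ∀ x ∈ Set.Icc a b, |g'' x| ≤ M)
    {δ : ℝ} (hδ : 0 < δ) (hg2 : ∀ x ∈ Set.Icc a b, 2 + δ ≤ g x) :
    ∃ (F s : ℝ → ℝ) (L η K : ℝ), 0 ≤ L ∧ 0 < η ∧ 0 ≤ K ∧
      (∀ x y, |F x - F y| ≤ L * |x - y|) ∧ (∀ x, η ≤ F x) ∧
      (∀ x ∈ Set.Icc a b, ∀ y ∈ Set.Icc a b,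
        |F y - F x - s x * (y - x)| ≤ K * (y - x) ^ 2) ∧
      ∀ x ∈ Set.Icc a b, F x = Real.arcosh (g x / 2) := by
  obtain ⟨M, hM⟩ := hM
  set Φ : ℝ → ℝ := fun x => Real.arcosh (g x / 2) with hΦ
  set S : ℝ → ℝ := fun t => (√(t ^ 2 - 1))⁻¹ with hS
  set S' : ℝ → ℝ := fun t => -(2 * t / (2 * √(t ^ 2 - 1))) / √(t ^ 2 - 1) ^ 2 with hS'
  set s : ℝ → ℝ := fun x => S (g x / 2) * (g' x / 2) with hs
  have hg1 : ∀ x ∈ Set.Icc a b, 1 < g x / 2 := fun x hx => by linarith [hg2 x hx]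
  have hpos : ∀ t : ℝ, 1 < t → 0 < t ^ 2 - 1 := fun t ht => by nlinarith
  have hSd : ∀ t : ℝ, 1 < t → HasDerivAt S (S' t) t := by
    intro t ht
    have h1 : HasDerivAt (fun t : ℝ => t ^ 2 - 1) (2 * t) t := by
      simpa using (hasDerivAt_pow 2 t).sub_const 1
    exact (h1.sqrt (hpos t ht).ne').inv (Real.sqrt_ne_zero'.2 (hpos t ht))
  have hΦd : ∀ x ∈ Set.Icc a b, HasDerivWithinAt Φ (s x) (Set.Icc a b) x := fun x hx =>
    HasDerivAt.comp_hasDerivWithinAt (h₂ := Real.arcosh) x (Real.hasDerivAt_arcosh (hg1 x hx))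
      ((hg x hx).div_const 2)
  have hsd : ∀ x ∈ Set.Icc a b, HasDerivWithinAt s
      (S' (g x / 2) * (g' x / 2) * (g' x / 2) + S (g x / 2) * (g'' x / 2)) (Set.Icc a b) x :=
    fun x hx => (HasDerivAt.comp_hasDerivWithinAt (h₂ := S) x (hSd _ (hg1 x hx))
      ((hg x hx).div_const 2)).mul ((hg' x hx).div_const 2)
  have cg : ContinuousOn (fun x => g x / 2) (Set.Icc a b) := fun x hx =>
    ((hg x hx).div_const 2).continuousWithinAt
  have cg' : ContinuousOn (fun x => g' x / 2) (Set.Icc a b) := fun x hx =>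
    ((hg' x hx).div_const 2).continuousWithinAt
  have hsq : ∀ x ∈ Set.Icc a b, √((g x / 2) ^ 2 - 1) ≠ 0 := fun x hx =>
    Real.sqrt_ne_zero'.2 (hpos _ (hg1 x hx))
  have cS : ContinuousOn (fun x => S (g x / 2)) (Set.Icc a b) :=
    ((cg.pow 2).sub continuousOn_const).sqrt.inv₀ hsq
  have cS' : ContinuousOn (fun x => S' (g x / 2)) (Set.Icc a b) := by
    have c1 := ((cg.pow 2).sub (continuousOn_const (c := (1 : ℝ)))).sqrt
    refine ContinuousOn.div (((continuousOn_const.mul cg).div (continuousOn_const.mul c1)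
      fun x hx => mul_ne_zero two_ne_zero (hsq x hx)).neg) (c1.pow 2)
      fun x hx => pow_ne_zero 2 (hsq x hx)
  obtain ⟨C₁, hC₁⟩ := isCompact_Icc.exists_bound_of_continuousOn ((cS'.mul cg').mul cg')
  obtain ⟨C₂, hC₂⟩ := isCompact_Icc.exists_bound_of_continuousOn cS
  obtain ⟨L, hL⟩ := isCompact_Icc.exists_bound_of_continuousOn (cS.mul cg')
  have ha : a ∈ Set.Icc a b := Set.left_mem_Icc.2 hab.le
  have hL0 : 0 ≤ L := (norm_nonneg _).trans (hL a ha)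
  have hC₂0 : 0 ≤ C₂ := (norm_nonneg _).trans (hC₂ a ha)
  set K : ℝ := C₁ + C₂ * (M / 2) with hK
  have hbound : ∀ x ∈ Set.Icc a b,
      ‖S' (g x / 2) * (g' x / 2) * (g' x / 2) + S (g x / 2) * (g'' x / 2)‖ ≤ K := by
    intro x hx
    refine (norm_add_le _ _).trans (add_le_add (hC₁ x hx) ?_)
    rw [norm_mul]
    refine mul_le_mul (hC₂ x hx) ?_ (norm_nonneg _) hC₂0
    rw [Real.norm_eq_abs, abs_div, abs_two]
    linarith [hM x hx]
  have hK0 : 0 ≤ K := (norm_nonneg _).trans (hbound a ha)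
  have hsL : ∀ x ∈ Set.Icc a b, ∀ y ∈ Set.Icc a b, ‖s y - s x‖ ≤ K * ‖y - x‖ := fun x hx y hy =>
    (convex_Icc a b).norm_image_sub_le_of_norm_hasDerivWithin_le hsd hbound hx hy
  have hT : ∀ x ∈ Set.Icc a b, ∀ y ∈ Set.Icc a b,
      |Φ y - Φ x - s x * (y - x)| ≤ K * (y - x) ^ 2 := by
    intro x hx y hy
    have hsub : Set.uIcc x y ⊆ Set.Icc a b := Set.uIcc_subset_Icc hx hy
    have h1 := (convex_uIcc x y).norm_image_sub_le_of_norm_hasDerivWithin_le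
      (f := fun t => Φ t - s x * t) (f' := fun t => s t - s x * 1) (C := K * ‖y - x‖)
      (fun t ht => ((hΦd t (hsub ht)).mono hsub).sub ((hasDerivWithinAt_id t _).const_mul (s x)))
      (fun t ht => by
        rw [mul_one]
        refine (hsL x hx t (hsub ht)).trans (mul_le_mul_of_nonneg_left ?_ hK0)
        exact Set.abs_sub_left_of_mem_uIcc ht)
      Set.left_mem_uIcc Set.right_mem_uIcc
    have h2 : K * |y - x| * |y - x| = K * (y - x) ^ 2 := by rw [mul_assoc, ← sq, sq_abs]
    have h3 : Φ y - Φ x - s x * (y - x) = Φ y - s x * y - (Φ x - s x * x) := by ring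
    rw [Real.norm_eq_abs, Real.norm_eq_abs, h2] at h1
    rwa [h3]
  have hproj : ∀ x ∈ Set.Icc a b, Φ (Set.projIcc a b hab.le x) = Φ x := fun x hx => by
    rw [Set.projIcc_of_mem hab.le hx]
  refine ⟨fun x => Φ (Set.projIcc a b hab.le x), s, L, Real.arcosh ((2 + δ) / 2), K, hL0,
    Real.arcosh_pos (by linarith), hK0, fun x y => ?_, fun x => ?_, fun x hx y hy => ?_,
    fun x hx => hproj x hx⟩
  · have h1 := (convex_Icc a b).norm_image_sub_le_of_norm_hasDerivWithin_le hΦd hL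
      (Set.projIcc a b hab.le y).2 (Set.projIcc a b hab.le x).2
    refine h1.trans (mul_le_mul_of_nonneg_left ?_ hL0)
    exact Set.abs_projIcc_sub_projIcc hab.le
  · have h1 := hg2 _ (Set.projIcc a b hab.le x).2
    refine (Real.arcosh_le_arcosh (by linarith) (by linarith)).2 ?_
    linarith
  · simp only [hproj x hx, hproj y hy]
    exact hT x hx y hy

end Arcosh

section LimitPoints

lemma mapClusterPt_fract_natCast_mul {c : ℝ} (hc : Irrational c) {θ : ℝ}
    (hθ : θ ∈ Set.Icc (0 : ℝ) 1) : MapClusterPt θ atTop (fun n : ℕ => Int.fract (n * c)) := by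
  have hclosed : IsClosed {x : ℝ | MapClusterPt x atTop (fun n : ℕ => Int.fract (n * c))} :=
    isClosed_setOfPred_clusterPt
  suffices h : Set.Ioo (0 : ℝ) 1 ⊆
      {x : ℝ | MapClusterPt x atTop (fun n : ℕ => Int.fract (n * c))} by
    have h1 := closure_minimal h hclosed
    rw [closure_Ioo zero_ne_one] at h1
    exact h1 hθ
  intro t ht
  have hdense : DenseRange (fun n : ℤ => n • (c : AddCircle (1 : ℝ))) := by
    rw [AddCircle.denseRange_zsmul_coe_iff]
    simpa using hc
  have h1 : MapClusterPt (t : AddCircle (1 : ℝ)) atTop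
      (fun n : ℕ => n • (c : AddCircle (1 : ℝ))) :=
    ((mapClusterPt_atTop_nsmul_tfae (t : AddCircle (1 : ℝ)) (c : AddCircle (1 : ℝ))).out 0 3).2
      (hdense _)
  have hne : (t : AddCircle (1 : ℝ)) ≠ ((0 : ℝ) : AddCircle (1 : ℝ)) := by
    intro h
    have h2 := congrArg (AddCircle.equivIco (1 : ℝ) 0) h
    rw [Subtype.ext_iff, AddCircle.coe_equivIco_mk_apply, AddCircle.coe_equivIco_mk_apply] at h2
    simp only [div_one, mul_one, Int.fract_zero, Int.fract_eq_self.2 ⟨ht.1.le, ht.2⟩] at h2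
    exact ht.1.ne' h2
  have h2 := h1.continuousAt_comp (f := fun x => ((AddCircle.equivIco (1 : ℝ) 0 x : ℝ)))
    (continuous_subtype_val.continuousAt.comp (AddCircle.continuousAt_equivIco (1 : ℝ) 0 hne))
  rw [AddCircle.coe_equivIco_mk_apply] at h2
  simp only [div_one, mul_one, Int.fract_eq_self.2 ⟨ht.1.le, ht.2⟩] at h2
  refine h2.congrFun (Eventually.of_forall fun n => ?_)
  simp only [Function.comp_apply, ← AddCircle.coe_nsmul, AddCircle.coe_equivIco_mk_apply,
    nsmul_eq_mul, div_one, mul_one]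

lemma setOf_subseq_limits_eq_uIcc {c : ℝ} (hc : Irrational c) {x : ℕ → ℝ} {P κ : ℝ}
    (hx : Tendsto (fun n : ℕ => x n * Real.exp (-(Int.fract (n * c) * κ))) atTop (𝓝 P)) :
    {L : ℝ | ∃ φ : ℕ → ℕ, StrictMono φ ∧ Tendsto (fun k : ℕ => x (φ k)) atTop (𝓝 L)} =
      Set.uIcc P (P * Real.exp κ) := by
  have hdiff : Tendsto (fun n : ℕ => x n - P * Real.exp (Int.fract (n * c) * κ)) atTop (𝓝 0) := by
    have h1 : Tendsto (fun n : ℕ => |x n * Real.exp (-(Int.fract (n * c) * κ)) - P| *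
        Real.exp |κ|) atTop (𝓝 0) := by
      simpa using ((hx.sub_const P).abs).mul_const (Real.exp |κ|)
    refine squeeze_zero_norm (fun n => ?_) h1
    have e : x n - P * Real.exp (Int.fract (n * c) * κ) =
        (x n * Real.exp (-(Int.fract (n * c) * κ)) - P) * Real.exp (Int.fract (n * c) * κ) := by
      rw [sub_mul, mul_assoc, ← Real.exp_add]; simp
    rw [e, Real.norm_eq_abs, abs_mul, Real.abs_exp]
    gcongr
    calc Int.fract (n * c) * κ ≤ Int.fract (n * c) * |κ| :=
          mul_le_mul_of_nonneg_left (le_abs_self κ) (Int.fract_nonneg _)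
      _ ≤ 1 * |κ| :=
          mul_le_mul_of_nonneg_right (Int.fract_lt_one _).le (abs_nonneg κ)
      _ = |κ| := one_mul _
  have hmem : ∀ t ∈ Set.Icc (0 : ℝ) 1, P * Real.exp (t * κ) ∈ Set.uIcc P (P * Real.exp κ) := by
    intro t ht
    rw [Set.mem_uIcc]
    rcases le_total 0 P with hP | hP <;> rcases le_total 0 κ with hκ | hκ
    · exact Or.inl ⟨le_mul_of_one_le_right hP (Real.one_le_exp (mul_nonneg ht.1 hκ)),
        mul_le_mul_of_nonneg_left (Real.exp_le_exp.2 (by nlinarith [ht.2])) hP⟩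
    · exact Or.inr ⟨mul_le_mul_of_nonneg_left (Real.exp_le_exp.2 (by nlinarith [ht.2])) hP,
        mul_le_of_le_one_right hP
          (Real.exp_le_one_iff.2 (mul_nonpos_of_nonneg_of_nonpos ht.1 hκ))⟩
    · refine Or.inr ⟨mul_le_mul_of_nonpos_left (Real.exp_le_exp.2 (by nlinarith [ht.2])) hP, ?_⟩
      nlinarith [Real.one_le_exp (mul_nonneg ht.1 hκ)]
    · refine Or.inl ⟨?_, mul_le_mul_of_nonpos_left (Real.exp_le_exp.2 (by nlinarith [ht.2])) hP⟩
      nlinarith [Real.exp_le_one_iff.2 (mul_nonpos_of_nonneg_of_nonpos ht.1 hκ)]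
  ext y
  constructor
  · rintro ⟨φ, hφ, hy⟩
    have h1 := hy.sub (hdiff.comp hφ.tendsto_atTop)
    rw [sub_zero] at h1
    refine isClosed_Icc.mem_of_tendsto h1 (Eventually.of_forall fun k => ?_)
    simp only [Function.comp_apply, sub_sub_cancel]
    exact hmem _ ⟨Int.fract_nonneg _, (Int.fract_lt_one _).le⟩
  · intro hy
    have hcont : Continuous fun t : ℝ => P * Real.exp (t * κ) := by fun_prop
    obtain ⟨t, ht, rfl⟩ : y ∈ (fun t : ℝ => P * Real.exp (t * κ)) '' Set.uIcc 0 1 := by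
      refine intermediate_value_uIcc hcont.continuousOn ?_
      simpa using hy
    rw [Set.uIcc_of_le zero_le_one] at ht
    obtain ⟨φ, hφ, h1⟩ := ((mapClusterPt_fract_natCast_mul hc ht).continuousAt_comp
      hcont.continuousAt).tendsto_subseq
    refine ⟨φ, hφ, ?_⟩
    have h2 := h1.add (hdiff.comp hφ.tendsto_atTop)
    rw [add_zero] at h2
    refine h2.congr fun k => ?_
    simp

end LimitPoints

lemma rpow_quarter_mul {X Y : ℝ} (hX : 0 ≤ X) (hY : 0 ≤ Y) :
    (X ^ 2 * Y ^ 2) ^ ((1 : ℝ) / 4) = √X * √Y := by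
  rw [← mul_pow, ← Real.sqrt_mul hX, Real.sqrt_eq_rpow, ← Real.rpow_natCast,
    ← Real.rpow_mul (mul_nonneg hX hY)]
  norm_num

lemma szego_constant_eq {a b : ℝ} (ha : 0 < a) (hb : 0 < b) :
    √(1 / ((1 - Real.exp (-a) ^ 2) * (1 - Real.exp (-b) ^ 2))) * Real.exp ((a + b) / 2) =
      Real.exp (a + b) / (√(2 * Real.sinh a) * √(2 * Real.sinh b)) := by
  have h : ∀ t : ℝ, 1 - Real.exp (-t) ^ 2 = Real.exp (-t) * (2 * Real.sinh t) := by
    intro t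
    have : Real.exp (-t) * Real.exp t = 1 := by rw [← Real.exp_add]; simp
    rw [Real.sinh_eq]
    linear_combination -this
  have hsa : 0 < 2 * Real.sinh a := mul_pos two_pos (Real.sinh_pos_iff.2 ha)
  have hsb : 0 < 2 * Real.sinh b := mul_pos two_pos (Real.sinh_pos_iff.2 hb)
  have e : 1 / ((1 - Real.exp (-a) ^ 2) * (1 - Real.exp (-b) ^ 2)) =
      Real.exp ((a + b) / 2) ^ 2 / ((2 * Real.sinh a) * (2 * Real.sinh b)) := by
    rw [h, h, ← Real.exp_nat_mul, Real.exp_neg, Real.exp_neg]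
    push_cast
    rw [mul_div_cancel₀ _ two_ne_zero, Real.exp_add]
    field_simp
  rw [e, Real.sqrt_div (by positivity), Real.sqrt_sq (Real.exp_pos _).le, Real.sqrt_mul hsa.le,
    div_mul_eq_mul_div, ← Real.exp_add, add_halves]

lemma two_cosh_sq_sub_four (t : ℝ) : (2 * Real.cosh t) ^ 2 - 4 = (2 * Real.sinh t) ^ 2 := by
  rw [mul_pow, mul_pow, Real.cosh_sq]; ring

lemma sqrt_two_cosh_sq_sub_four {t : ℝ} (ht : 0 ≤ t) :
    √((2 * Real.cosh t) ^ 2 - 4) = 2 * Real.sinh t := by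
  rw [two_cosh_sq_sub_four, Real.sqrt_sq (mul_nonneg zero_le_two (Real.sinh_nonneg_iff.2 ht))]

lemma two_cosh_add_two_sinh (t : ℝ) : 2 * Real.cosh t + 2 * Real.sinh t = 2 * Real.exp t := by
  rw [← mul_add, Real.cosh_add_sinh]

/-- Splitting the determinant at the jump: the normalised determinant converges. -/
lemma tendsto_continuant_jump {c : ℝ} (hc0 : 0 < c) (hc1 : c < 1) {F₀ s₀ F₁ s₁ : ℝ → ℝ}
    {L₀ L₁ η₀ η₁ K₀ K₁ : ℝ} {D : ℕ → ℝ} {d : ℕ → ℕ → ℝ}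
    (hL₀0 : 0 ≤ L₀) (hL₀ : ∀ x y, |F₀ x - F₀ y| ≤ L₀ * |x - y|)
    (hη₀ : 0 < η₀) (hFη₀ : ∀ x, η₀ ≤ F₀ x) (hK₀ : 0 ≤ K₀)
    (hT₀ : ∀ x ∈ Set.Icc 0 c, ∀ y ∈ Set.Icc 0 c,
      |F₀ y - F₀ x - s₀ x * (y - x)| ≤ K₀ * (y - x) ^ 2)
    (hL₁0 : 0 ≤ L₁) (hL₁ : ∀ x y, |F₁ x - F₁ y| ≤ L₁ * |x - y|)
    (hη₁ : 0 < η₁) (hFη₁ : ∀ x, η₁ ≤ F₁ x) (hK₁ : 0 ≤ K₁)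
    (hT₁ : ∀ x ∈ Set.Icc c 1, ∀ y ∈ Set.Icc c 1,
      |F₁ y - F₁ x - s₁ x * (y - x)| ≤ K₁ * (y - x) ^ 2)
    (hD : ∀ n, D n = continuant (d n) n)
    (hd₀ : ∀ n k : ℕ, ((k : ℝ) + 1) / n ≤ c → d n k = 2 * Real.cosh (F₀ (((k : ℝ) + 1) / n)))
    (hd₁ : ∀ n k : ℕ, c < ((k : ℝ) + 1) / n → k < n →
      d n k = 2 * Real.cosh (F₁ (((k : ℝ) + 1) / n))) :
    Tendsto (fun n : ℕ => D n * Real.exp (-(n * ((∫ x in (0 : ℝ)..c, F₀ x) + ∫ x in c..1, F₁ x))) *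
        Real.exp (-(Int.fract (n * c) * (F₁ c - F₀ c)))) atTop
      (𝓝 ((√(1 / ((1 - Real.exp (-F₀ 0) ^ 2) * (1 - Real.exp (-F₀ c) ^ 2))) *
          Real.exp ((F₀ 0 + F₀ c) / 2)) *
        (√(1 / ((1 - Real.exp (-F₁ c) ^ 2) * (1 - Real.exp (-F₁ 1) ^ 2))) *
          Real.exp ((F₁ c + F₁ 1) / 2)) *
        (1 - Real.exp (-(F₀ c + F₁ c))) * Real.exp (-(F₀ 0 + F₁ c)))) := by
  set θ : ℕ → ℝ := fun n => Int.fract (n * c) with hθ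
  have hθ0 : ∀ n, 0 ≤ θ n := fun n => Int.fract_nonneg _
  have hθ1 : ∀ n, θ n < 1 := fun n => Int.fract_lt_one _
  set m : ℕ → ℕ := fun n => ⌊n * c⌋₊ with hm
  have hmθ : ∀ n : ℕ, (m n : ℝ) + θ n = n * c := fun n => by
    have : 0 ≤ n * c := by positivity
    simp only [hm, hθ, natCast_floor_eq_intCast_floor this, Int.floor_add_fract]
  have hsize : ∀ᶠ n : ℕ in atTop, ∃ p q : ℕ, m n = p + 2 ∧ n = m n + q + 2 := by
    have h1 : ∀ᶠ n : ℕ in atTop, 3 ≤ n * c :=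
      (tendsto_natCast_atTop_atTop.atTop_mul_const hc0).eventually_ge_atTop 3
    have h2 : ∀ᶠ n : ℕ in atTop, 3 ≤ n * (1 - c) :=
      (tendsto_natCast_atTop_atTop.atTop_mul_const (sub_pos.2 hc1)).eventually_ge_atTop 3
    filter_upwards [h1, h2] with n h1 h2
    have h3 := hmθ n
    have h4 : (2 : ℝ) < m n + 1 := by linarith [hθ1 n]
    have h5 : (m n : ℝ) + 3 ≤ n := by nlinarith [hθ0 n]
    norm_cast at h4 h5
    exact ⟨m n - 2, n - m n - 2, by omega, by omega⟩
  have cast_eq : ∀ {n p q : ℕ}, m n = p + 2 → n = m n + q + 2 →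
      (p : ℝ) + 2 + θ n = n * c ∧ (n : ℝ) = p + 2 + q + 2 := by
    intro n p q h1 h2
    have h3 := hmθ n
    have h4 : (n : ℝ) = ((m n + q + 2 : ℕ) : ℝ) := by exact_mod_cast h2
    rw [h1] at h3 h4
    push_cast at h3 h4
    exact ⟨h3, h4⟩
  have A := tendsto_continuant_piece (u := fun _ => 1) (v := θ) (N := fun n => m n - 1)
    hL₀0 hL₀ hη₀ hFη₀ hK₀ hT₀ hc0 (by linarith) (fun _ => by norm_num)
    (fun n => ⟨hθ0 n, by linarith [hθ1 n]⟩) (by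
      filter_upwards [hsize] with n ⟨p, q, h1, h2⟩
      obtain ⟨h3, h4⟩ := cast_eq h1 h2
      rw [h1, show p + 2 - 1 = p + 1 by omega]
      push_cast; linarith)
  have A' := tendsto_continuant_piece (u := fun _ => 1) (v := fun n => θ n + 1)
    (N := fun n => m n - 2)
    hL₀0 hL₀ hη₀ hFη₀ hK₀ hT₀ hc0 (by linarith) (fun _ => by norm_num)
    (fun n => ⟨by linarith [hθ0 n], by linarith [hθ1 n]⟩) (by
      filter_upwards [hsize] with n ⟨p, q, h1, h2⟩
      obtain ⟨h3, h4⟩ := cast_eq h1 h2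
      rw [h1, show p + 2 - 2 = p by omega]
      linarith)
  have B := tendsto_continuant_piece (u := fun n => 1 - θ n) (v := fun _ => 0)
    (N := fun n => n - m n - 1)
    hL₁0 hL₁ hη₁ hFη₁ hK₁ hT₁ hc1 (by linarith)
    (fun n => ⟨by linarith [hθ1 n], by linarith [hθ0 n]⟩) (fun _ => by norm_num) (by
      filter_upwards [hsize] with n ⟨p, q, h1, h2⟩
      obtain ⟨h3, h4⟩ := cast_eq h1 h2
      rw [show n - m n - 1 = q + 1 by omega]
      push_cast; linarith)
  have B' := tendsto_continuant_piece (u := fun n => 2 - θ n) (v := fun _ => 0)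
    (N := fun n => n - m n - 2)
    hL₁0 hL₁ hη₁ hFη₁ hK₁ hT₁ hc1 (by linarith)
    (fun n => ⟨by linarith [hθ1 n], by linarith [hθ0 n]⟩) (fun _ => by norm_num) (by
      filter_upwards [hsize] with n ⟨p, q, h1, h2⟩
      obtain ⟨h3, h4⟩ := cast_eq h1 h2
      rw [show n - m n - 2 = q by omega]
      linarith)
  have hlim := ((A.mul B).sub ((A'.mul B').mul_const (Real.exp (-(F₀ c + F₁ c))))).mul_const
    (Real.exp (-(F₀ 0 + F₁ c)))
  rw [← mul_one_sub] at hlim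
  refine hlim.congr' ?_
  filter_upwards [hsize] with n ⟨p, q, h1, h2⟩
  obtain ⟨h3, h4⟩ := cast_eq h1 h2
  have hn0 : (0 : ℝ) < n := by rw [h4]; positivity
  rw [hD n, show m n - 1 = p + 1 by omega, show m n - 2 = p by omega,
    show n - m n - 1 = q + 1 by omega, show n - m n - 2 = q by omega]
  have hsplit : continuant (d n) n = continuant (d n) (p + 2) *
      continuant (fun k => d n (p + 2 + k)) (q + 2) -
      continuant (d n) (p + 1) * continuant (fun k => d n (p + 3 + k)) (q + 1) := by
    have := continuant_add (d n) (p + 1) (q + 1)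
    rwa [show p + 1 + 1 + (q + 1 + 1) = n by omega] at this
  have left : ∀ j, j ≤ p + 2 →
      continuant (fun k => 2 * Real.cosh (F₀ (0 + (1 + k) / n))) j = continuant (d n) j := by
    intro j hj
    refine continuant_congr fun k hk => ?_
    have hk' : (k : ℝ) + 1 ≤ p + 2 := by exact_mod_cast (by omega : k + 1 ≤ p + 2)
    rw [hd₀ n k, zero_add, add_comm (1 : ℝ)]
    rw [div_le_iff₀ hn0]
    linarith [hθ0 n]
  have right : ∀ (w : ℝ) (r j : ℕ), w = r - n * c → p + 2 < r → r + j ≤ n + 1 →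
      continuant (fun k => 2 * Real.cosh (F₁ (c + (w + k) / n))) j =
        continuant (fun k => d n (r - 1 + k)) j := by
    intro w r j hw hr hrj
    refine continuant_congr fun k hk => ?_
    have hr' : (p : ℝ) + 3 ≤ r := by exact_mod_cast hr
    have hk0 : (0 : ℝ) ≤ k := Nat.cast_nonneg k
    have e : ((r - 1 + k : ℕ) : ℝ) + 1 = r + k := by
      exact_mod_cast (by omega : r - 1 + k + 1 = r + k)
    have e2 : c + (w + k) / n = (r + k) / n := by
      rw [hw]; field_simp; ring
    rw [hd₁ n (r - 1 + k) ?_ (by omega), e, e2]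
    rw [e, lt_div_iff₀ hn0]
    linarith [hθ1 n]
  rw [left _ le_rfl, left _ (by omega), right (1 - θ n) (p + 3) (q + 2) (by
    push_cast; linarith) (by omega) (by omega), right (2 - θ n) (p + 4) (q + 1) (by
    push_cast; linarith) (by omega) (by omega), hsplit]
  simp only [show p + 3 - 1 = p + 2 by omega, show p + 4 - 1 = p + 3 by omega]
  set I₀ := ∫ x in (0 : ℝ)..c, F₀ x
  set I₁ := ∫ x in c..1, F₁ x
  set X := continuant (d n) (p + 2)
  set Y := continuant (fun k => d n (p + 2 + k)) (q + 2)
  set X' := continuant (d n) (p + 1)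
  set Y' := continuant (fun k => d n (p + 3 + k)) (q + 1)
  have e1 : Real.exp (1 * F₀ 0 + θ n * F₀ c - n * I₀) *
      Real.exp ((1 - θ n) * F₁ c + 0 * F₁ 1 - n * I₁) * Real.exp (-(F₀ 0 + F₁ c)) =
      Real.exp (-(n * (I₀ + I₁))) * Real.exp (-(θ n * (F₁ c - F₀ c))) := by
    simp only [← Real.exp_add]; ring_nf
  have e2 : Real.exp (1 * F₀ 0 + (θ n + 1) * F₀ c - n * I₀) *
      Real.exp ((2 - θ n) * F₁ c + 0 * F₁ 1 - n * I₁) * Real.exp (-(F₀ c + F₁ c)) *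
      Real.exp (-(F₀ 0 + F₁ c)) =
      Real.exp (-(n * (I₀ + I₁))) * Real.exp (-(θ n * (F₁ c - F₀ c))) := by
    simp only [← Real.exp_add]; ring_nf
  linear_combination X * Y * e1 - X' * Y' * e2

lemma jump_constant_eq {a b p d : ℝ} (ha : 0 < a) (hb : 0 < b) (hp : 0 < p) (hd : 0 < d) :
    (√(1 / ((1 - Real.exp (-a) ^ 2) * (1 - Real.exp (-b) ^ 2))) * Real.exp ((a + b) / 2)) *
        (√(1 / ((1 - Real.exp (-p) ^ 2) * (1 - Real.exp (-d) ^ 2))) * Real.exp ((p + d) / 2)) *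
        (1 - Real.exp (-(b + p))) * Real.exp (-(a + p)) =
      ((1 / 2) * (2 * Real.cosh d + √((2 * Real.cosh d) ^ 2 - 4)) /
          (((2 * Real.cosh a) ^ 2 - 4) * ((2 * Real.cosh d) ^ 2 - 4)) ^ ((1 : ℝ) / 4)) *
        ((2 * Real.cosh b - 2 * Real.cosh p + √((2 * Real.cosh p) ^ 2 - 4) +
            √((2 * Real.cosh b) ^ 2 - 4)) /
          (2 * (((2 * Real.cosh p) ^ 2 - 4) * ((2 * Real.cosh b) ^ 2 - 4)) ^ ((1 : ℝ) / 4))) := by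
  have hs : ∀ {t : ℝ}, 0 < t → 0 < 2 * Real.sinh t := fun ht =>
    mul_pos two_pos (Real.sinh_pos_iff.2 ht)
  rw [szego_constant_eq ha hb, szego_constant_eq hp hd, sqrt_two_cosh_sq_sub_four hd.le,
    sqrt_two_cosh_sq_sub_four hp.le, sqrt_two_cosh_sq_sub_four hb.le, two_cosh_add_two_sinh]
  simp only [two_cosh_sq_sub_four]
  rw [rpow_quarter_mul (hs ha).le (hs hd).le, rpow_quarter_mul (hs hp).le (hs hb).le]
  have e : 2 * Real.cosh b - 2 * Real.cosh p + 2 * Real.sinh p + 2 * Real.sinh b =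
      2 * (Real.exp b - Real.exp (-p)) := by
    rw [← Real.cosh_add_sinh b, ← Real.cosh_sub_sinh p]; ring
  have e2 : Real.exp (a + b) * Real.exp (p + d) * (1 - Real.exp (-(b + p))) *
      Real.exp (-(a + p)) = Real.exp d * (Real.exp b - Real.exp (-p)) := by
    simp only [mul_sub, sub_mul, mul_one, ← Real.exp_add]
    ring_nf
  have h1 := Real.sqrt_pos.2 (hs ha)
  have h2 := Real.sqrt_pos.2 (hs hb)
  have h3 := Real.sqrt_pos.2 (hs hp)
  have h4 := Real.sqrt_pos.2 (hs hd)
  rw [e]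
  field_simp
  linear_combination e2

/-- For a symbol with a single jump at an irrational c (left-continuous at c,
f(c−) = g₀(c) = f(c), f(c+) = g₁(c)), the set of limit points of D_n(f)/G(f)ⁿ is
exactly the closed interval with endpoints α·β and α·β·γ. -/
theorem limit_points_irrational_jump
    (c : ℝ) (hc : Irrational c) (hc0 : 0 < c) (hc1 : c < 1)
    (f g0 g0' g0'' g1 g1' g1'' : ℝ → ℝ)
    (hd01 : ∀ x ∈ Set.Icc (0:ℝ) c, HasDerivWithinAt g0 (g0' x) (Set.Icc (0:ℝ) c) x)
    (hd02 : ∀ x ∈ Set.Icc (0:ℝ) c, HasDerivWithinAt g0' (g0'' x) (Set.Icc (0:ℝ) c) x)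
    (hbd0 : ∃ M : ℝ, ∀ x ∈ Set.Icc (0:ℝ) c, |g0'' x| ≤ M)
    (hd11 : ∀ x ∈ Set.Icc c 1, HasDerivWithinAt g1 (g1' x) (Set.Icc c 1) x)
    (hd12 : ∀ x ∈ Set.Icc c 1, HasDerivWithinAt g1' (g1'' x) (Set.Icc c 1) x)
    (hbd1 : ∃ M : ℝ, ∀ x ∈ Set.Icc c 1, |g1'' x| ≤ M)
    (hfg0 : ∀ x ∈ Set.Icc (0:ℝ) c, f x = g0 x)
    (hfg1 : ∀ x ∈ Set.Ioc c 1, f x = g1 x)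
    (hjump : g0 c ≠ g1 c)
    (δ : ℝ) (hδ : 0 < δ) (hf2 : ∀ x ∈ Set.Icc (0:ℝ) 1, 2 + δ < f x) :
    {L : ℝ | ∃ φ : ℕ → ℕ, StrictMono φ ∧
        Tendsto (fun k : ℕ => Dn f (φ k) / (Gf f) ^ (φ k)) atTop (𝓝 L)} =
      Set.uIcc
        (((1/2) * (f 1 + Real.sqrt (f 1 ^ 2 - 4)) /
            ((f 0 ^ 2 - 4) * (f 1 ^ 2 - 4)) ^ ((1:ℝ)/4)) *
          ((g0 c - g1 c + Real.sqrt ((g1 c) ^ 2 - 4) + Real.sqrt ((g0 c) ^ 2 - 4)) /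
            (2 * (((g1 c) ^ 2 - 4) * ((g0 c) ^ 2 - 4)) ^ ((1:ℝ)/4))))
        (((1/2) * (f 1 + Real.sqrt (f 1 ^ 2 - 4)) /
            ((f 0 ^ 2 - 4) * (f 1 ^ 2 - 4)) ^ ((1:ℝ)/4)) *
          ((g0 c - g1 c + Real.sqrt ((g1 c) ^ 2 - 4) + Real.sqrt ((g0 c) ^ 2 - 4)) /
            (2 * (((g1 c) ^ 2 - 4) * ((g0 c) ^ 2 - 4)) ^ ((1:ℝ)/4))) *
          ((g1 c + Real.sqrt ((g1 c) ^ 2 - 4)) /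
            (g0 c + Real.sqrt ((g0 c) ^ 2 - 4)))) := by
  have hc01 : c ∈ Set.Icc (0 : ℝ) c := ⟨hc0.le, le_rfl⟩
  have hcc1 : c ∈ Set.Icc c 1 := ⟨le_rfl, hc1.le⟩
  have hg0 : ∀ x ∈ Set.Icc (0 : ℝ) c, 2 + δ ≤ g0 x := fun x hx => by
    rw [← hfg0 x hx]; exact (hf2 x ⟨hx.1, hx.2.trans hc1.le⟩).le
  have hg1 : ∀ x ∈ Set.Icc c 1, 2 + δ ≤ g1 x := by
    have h1 : ∀ x ∈ Set.Ioc c 1, 2 + δ ≤ g1 x := fun x hx => by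
      rw [← hfg1 x hx]; exact (hf2 x ⟨hc0.le.trans hx.1.le, hx.2⟩).le
    intro x hx
    rcases hx.1.eq_or_lt with rfl | hlt
    · refine ge_of_tendsto (((hd11 c hcc1).continuousWithinAt.mono Set.Ioc_subset_Icc_self).tendsto)
        (b := 2 + δ) (x := 𝓝[Set.Ioc c 1] c) (hx := ?_) ?_
      · rw [nhdsWithin_Ioc_eq_nhdsGT hc1]; infer_instance
      · exact eventually_mem_nhdsWithin.mono h1
    · exact h1 x ⟨hlt, hx.2⟩
  obtain ⟨F₀, s₀, L₀, η₀, K₀, hL₀0, hη₀, hK₀, hL₀, hFη₀, hT₀, hF₀⟩ :=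
    exists_arcosh_extension hc0 hd01 hd02 hbd0 hδ hg0
  obtain ⟨F₁, s₁, L₁, η₁, K₁, hL₁0, hη₁, hK₁, hL₁, hFη₁, hT₁, hF₁⟩ :=
    exists_arcosh_extension hc1 hd11 hd12 hbd1 hδ hg1
  have hcosh₀ : ∀ x ∈ Set.Icc (0 : ℝ) c, g0 x = 2 * Real.cosh (F₀ x) := fun x hx => by
    rw [hF₀ x hx, Real.cosh_arcosh (by linarith [hg0 x hx])]; ring
  have hcosh₁ : ∀ x ∈ Set.Icc c 1, g1 x = 2 * Real.cosh (F₁ x) := fun x hx => by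
    rw [hF₁ x hx, Real.cosh_arcosh (by linarith [hg1 x hx])]; ring
  have hpos₀ : ∀ x, 0 < F₀ x := fun x => hη₀.trans_le (hFη₀ x)
  have hpos₁ : ∀ x, 0 < F₁ x := fun x => hη₁.trans_le (hFη₁ x)
  have hlog : ∀ t : ℝ, 0 < t →
      Real.log ((2 * Real.cosh t + √((2 * Real.cosh t) ^ 2 - 4)) / 2) = t := fun t ht => by
    rw [sqrt_two_cosh_sq_sub_four ht.le, two_cosh_add_two_sinh,
      mul_div_cancel_left₀ _ two_ne_zero, Real.log_exp]
  have hG : Gf f = Real.exp ((∫ x in (0 : ℝ)..c, F₀ x) + ∫ x in c..1, F₁ x) := by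
    have i₀ : Set.EqOn F₀ (fun x => Real.log ((f x + √(f x ^ 2 - 4)) / 2)) (Set.uIoc 0 c) := by
      intro x hx
      rw [Set.uIoc_of_le hc0.le] at hx
      have hx' : x ∈ Set.Icc (0 : ℝ) c := ⟨hx.1.le, hx.2⟩
      simp only [hfg0 x hx', hcosh₀ x hx', hlog _ (hpos₀ x)]
    have i₁ : Set.EqOn F₁ (fun x => Real.log ((f x + √(f x ^ 2 - 4)) / 2)) (Set.uIoc c 1) := by
      intro x hx
      rw [Set.uIoc_of_le hc1.le] at hx
      simp only [hfg1 x hx, hcosh₁ x ⟨hx.1.le, hx.2⟩, hlog _ (hpos₁ x)]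
    rw [Gf, ← intervalIntegral.integral_add_adjacent_intervals (b := c)
      (((continuous_of_abs_sub_le hL₀).intervalIntegrable 0 c).congr i₀)
      (((continuous_of_abs_sub_le hL₁).intervalIntegrable c 1).congr i₁),
      intervalIntegral.integral_congr_ae (Filter.Eventually.of_forall fun x hx => (i₀ hx).symm),
      intervalIntegral.integral_congr_ae (Filter.Eventually.of_forall fun x hx => (i₁ hx).symm)]
  have key := tendsto_continuant_jump (D := Dn f) (d := fun n k => f (((k : ℝ) + 1) / n))
    hc0 hc1 hL₀0 hL₀ hη₀ hFη₀ hK₀ hT₀ hL₁0 hL₁ hη₁ hFη₁ hK₁ hT₁ (Dn_eq_continuant f)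
    (fun n k h => by
      have h' : ((k : ℝ) + 1) / n ∈ Set.Icc (0 : ℝ) c := ⟨by positivity, h⟩
      rw [hfg0 _ h', hcosh₀ _ h'])
    (fun n k h hk => by
      have hn0 : (0 : ℝ) < n := by exact_mod_cast (Nat.zero_le k).trans_lt hk
      have h' : ((k : ℝ) + 1) / n ≤ 1 := by
        rw [div_le_one hn0]; exact_mod_cast hk
      rw [hfg1 _ ⟨h, h'⟩, hcosh₁ _ ⟨h.le, h'⟩])
  rw [jump_constant_eq (hpos₀ 0) (hpos₀ c) (hpos₁ c) (hpos₁ 1)] at key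
  have hf0 : f 0 = 2 * Real.cosh (F₀ 0) := by
    rw [hfg0 0 ⟨le_rfl, hc0.le⟩, hcosh₀ 0 ⟨le_rfl, hc0.le⟩]
  have hf1 : f 1 = 2 * Real.cosh (F₁ 1) := by
    rw [hfg1 1 ⟨hc1, le_rfl⟩, hcosh₁ 1 ⟨hc1.le, le_rfl⟩]
  have hγ : (g1 c + √(g1 c ^ 2 - 4)) / (g0 c + √(g0 c ^ 2 - 4)) = Real.exp (F₁ c - F₀ c) := by
    rw [hcosh₀ c hc01, hcosh₁ c hcc1, sqrt_two_cosh_sq_sub_four (hpos₀ c).le,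
      sqrt_two_cosh_sq_sub_four (hpos₁ c).le, two_cosh_add_two_sinh, two_cosh_add_two_sinh,
      mul_div_mul_left _ _ two_ne_zero, Real.exp_sub]
  rw [hγ, hf0, hf1, hcosh₀ c hc01, hcosh₁ c hcc1]
  refine setOf_subseq_limits_eq_uIcc hc (x := fun n => Dn f n / Gf f ^ n) (key.congr fun n => ?_)
  rw [hG, ← Real.exp_nat_mul, div_eq_mul_inv, ← Real.exp_neg]
end
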